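/- arXiv:0902.0279 — 13 statements merged into one kernel-verified Lean document; each statement's English description precedes it below -/
import Mathlib

section
/- Let S ⊆ ℝⁿ and let Φ : ℝ[X₁,…,Xₙ] → ℝ[X₁,…,Xₙ] be an S-nonnegativity preserver. If x ∈ S is a point with Φ(1)(x) = 0, then Φ(p)(x) = 0 for every polynomial p ∈ ℝ[X₁,…,Xₙ]. -/
/-- If an `S`-nonnegativity preserver `Φ` satisfies `Φ(1)(x) = 0` for some `x ∈ S`,
then `Φ(p)(x) = 0` for every polynomial `p`. -/
theorem nonnegativity_preserver_vanishes_where_image_of_one_vanishes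
    (n : ℕ) (S : Set (Fin n → ℝ))
    (Φ : MvPolynomial (Fin n) ℝ →ₗ[ℝ] MvPolynomial (Fin n) ℝ)
    (hΦ : ∀ p : MvPolynomial (Fin n) ℝ,
      (∀ x ∈ S, 0 ≤ MvPolynomial.eval x p) → ∀ x ∈ S, 0 ≤ MvPolynomial.eval x (Φ p))
    (x : Fin n → ℝ) (hx : x ∈ S) (h1 : MvPolynomial.eval x (Φ 1) = 0) :
    ∀ p : MvPolynomial (Fin n) ℝ, MvPolynomial.eval x (Φ p) = 0 := by
  intro p
  have key (t : ℝ) :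
      0 ≤ MvPolynomial.eval x (Φ (p ^ 2)) + 2 * t * MvPolynomial.eval x (Φ p) := by
    have h := hΦ ((p + t • 1) ^ 2) (fun y _ => by rw [map_pow]; positivity) x hx
    have hsq : (p + t • (1 : MvPolynomial (Fin n) ℝ)) ^ 2
        = p ^ 2 + (2 * t) • p + (t ^ 2) • 1 := by
      simp only [MvPolynomial.smul_eq_C_mul, map_mul, map_pow, map_ofNat]
      ring
    simpa [hsq, MvPolynomial.smul_eval, h1] using h
  by_contra hne
  have h := key (-(MvPolynomial.eval x (Φ (p ^ 2)) + 1) / (2 * MvPolynomial.eval x (Φ p)))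
  field_simp at h
  linarith
end

section
/- Let S ⊆ ℝⁿ be compact and let Φ : ℝ[X₁,…,Xₙ] → ℝ[X₁,…,Xₙ] be an S-nonnegativity preserver. Then for every polynomial p with p(x) > 0 for all x ∈ S, the zero set {x ∈ S : Φ(p)(x) = 0} equals the zero set {x ∈ S : Φ(1)(x) = 0}. In particular, Φ is an S-positivity preserver if and only if Φ(1)(x) > 0 for all x ∈ S. -/
open MvPolynomial in
/-- A polynomial positive on a compact set dominates every polynomial there up to a scalar, and a
nonnegativity preserver respects this domination. -/
theorem exists_eval_map_le_mul_of_isCompact {n : ℕ} {S : Set (Fin n → ℝ)} (hS : IsCompact S)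
    {Φ : MvPolynomial (Fin n) ℝ →ₗ[ℝ] MvPolynomial (Fin n) ℝ}
    (hΦ : ∀ p : MvPolynomial (Fin n) ℝ, (∀ x ∈ S, 0 ≤ eval x p) → ∀ x ∈ S, 0 ≤ eval x (Φ p))
    {p : MvPolynomial (Fin n) ℝ} (hp : ∀ x ∈ S, 0 < eval x p) (q : MvPolynomial (Fin n) ℝ) :
    ∃ C : ℝ, ∀ x ∈ S, eval x (Φ q) ≤ C * eval x (Φ p) := by
  have hcont : ContinuousOn (fun x => eval x q / eval x p) S :=
    (continuous_eval q).continuousOn.div (continuous_eval p).continuousOn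
      fun x hx => (hp x hx).ne'
  obtain ⟨C, hC⟩ := hS.bddAbove_image hcont
  refine ⟨C, fun x hx => ?_⟩
  have h := hΦ (C • p - q) (fun y hy => ?_) x hx
  · simpa [smul_eval] using h
  · have hy' := (div_le_iff₀ (hp y hy)).1 (hC (Set.mem_image_of_mem _ hy))
    simpa [smul_eval] using hy'

/-- For compact `S` and an `S`-nonnegativity preserver `Φ`: for every `p` strictly positive
on `S`, the zero set of `Φ(p)` in `S` equals the zero set of `Φ(1)` in `S`; in particular,
`Φ` is an `S`-positivity preserver iff `Φ(1) > 0` on `S`. -/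
theorem zero_locus_eq_and_positivity_iff_of_compact
    (n : ℕ) (S : Set (Fin n → ℝ)) (hS : IsCompact S)
    (Φ : MvPolynomial (Fin n) ℝ →ₗ[ℝ] MvPolynomial (Fin n) ℝ)
    (hΦ : ∀ p : MvPolynomial (Fin n) ℝ,
      (∀ x ∈ S, 0 ≤ MvPolynomial.eval x p) → ∀ x ∈ S, 0 ≤ MvPolynomial.eval x (Φ p)) :
    (∀ p : MvPolynomial (Fin n) ℝ, (∀ x ∈ S, 0 < MvPolynomial.eval x p) →
      {x ∈ S | MvPolynomial.eval x (Φ p) = 0} = {x ∈ S | MvPolynomial.eval x (Φ 1) = 0}) ∧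
    ((∀ p : MvPolynomial (Fin n) ℝ,
        (∀ x ∈ S, 0 < MvPolynomial.eval x p) → ∀ x ∈ S, 0 < MvPolynomial.eval x (Φ p)) ↔
      ∀ x ∈ S, 0 < MvPolynomial.eval x (Φ 1)) := by
  have one_pos_on : ∀ x ∈ S, 0 < MvPolynomial.eval x (1 : MvPolynomial (Fin n) ℝ) := by simp
  have zero_of_zero : ∀ p q : MvPolynomial (Fin n) ℝ, (∀ x ∈ S, 0 < MvPolynomial.eval x p) →
      (∀ x ∈ S, 0 < MvPolynomial.eval x q) → ∀ x ∈ S,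
      MvPolynomial.eval x (Φ p) = 0 → MvPolynomial.eval x (Φ q) = 0 := by
    intro p q hp hq x hx h
    obtain ⟨C, hC⟩ := exists_eval_map_le_mul_of_isCompact hS hΦ hp q
    refine le_antisymm ?_ (hΦ q (fun y hy => (hq y hy).le) x hx)
    simpa [h] using hC x hx
  refine ⟨fun p hp => ?_, fun h => h 1 one_pos_on, fun h p hp x hx => ?_⟩
  · ext x
    exact and_congr_right fun hx =>
      ⟨zero_of_zero p 1 hp one_pos_on x hx, zero_of_zero 1 p one_pos_on hp x hx⟩
  · exact (hΦ p (fun y hy => (hp y hy).le) x hx).lt_of_ne'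
      fun h0 => (h x hx).ne' (zero_of_zero p 1 hp one_pos_on x hx h0)
end

section
/- Let S ⊆ ℝ be a closed set and let Φ : ℝ[X] → ℝ[X] be an S-nonnegativity preserver (one variable, n = 1). Then for every univariate polynomial p with p(x) > 0 for all x ∈ S, the zero set {x ∈ S : Φ(p)(x) = 0} equals the zero set {x ∈ S : Φ(1)(x) = 0}. In particular, Φ is an S-positivity preserver if and only if Φ(1)(x) > 0 for all x ∈ S. -/
/-- A real polynomial strictly positive on a closed set is bounded below there by a positive
constant. -/
lemma Polynomial.exists_pos_le_eval_of_isClosed {S : Set ℝ} (hS : IsClosed S)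
    {p : Polynomial ℝ} (hp : ∀ x ∈ S, 0 < p.eval x) :
    ∃ ε : ℝ, 0 < ε ∧ ∀ x ∈ S, ε ≤ p.eval x := by
  rcases S.eq_empty_or_nonempty with rfl | ⟨x₀, hx₀⟩
  · exact ⟨1, one_pos, by simp⟩
  rcases le_or_gt p.degree 0 with hdeg | hdeg
  · refine ⟨p.eval x₀, hp x₀ hx₀, fun x _ => ?_⟩
    rw [Polynomial.eq_C_of_degree_le_zero hdeg]
    simp
  · have htend : Filter.Tendsto (fun x : ℝ => ‖p.eval x‖) (Filter.cocompact ℝ) Filter.atTop :=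
      p.tendsto_norm_atTop hdeg tendsto_norm_cocompact_atTop
    obtain ⟨y, hy, hmin⟩ := p.continuous.norm.continuousOn.exists_isMinOn' hS hx₀
      ((htend.eventually_ge_atTop _).filter_mono inf_le_left)
    refine ⟨p.eval y, hp y hy, fun x hx => ?_⟩
    have h : ‖p.eval y‖ ≤ ‖p.eval x‖ := hmin hx
    rwa [Real.norm_of_nonneg (hp y hy).le, Real.norm_of_nonneg (hp x hx).le] at h

/-- A linear functional on a real algebra that is nonnegative on squares and vanishes at `1`
is zero. -/
lemma LinearMap.apply_eq_zero_of_map_one_eq_zero_of_sq_nonneg {A : Type*} [CommRing A]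
    [Algebra ℝ A] (L : A →ₗ[ℝ] ℝ) (hL : ∀ a, 0 ≤ L (a ^ 2)) (h₁ : L 1 = 0) (a : A) :
    L a = 0 := by
  have key : ∀ k : ℝ, 0 ≤ L (a ^ 2) - 2 * k * L a := fun k => by
    have hsq : (a - k • (1 : A)) ^ 2 = a ^ 2 - (2 * k) • a + (k ^ 2) • (1 : A) := by
      simp only [Algebra.smul_def, map_mul, map_pow, map_ofNat]
      ring
    simpa [hsq, h₁] using hL (a - k • (1 : A))
  by_contra hne
  have h := key ((L (a ^ 2) + 1) / (2 * L a))
  have heq : 2 * ((L (a ^ 2) + 1) / (2 * L a)) * L a = L (a ^ 2) + 1 := by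
    field_simp
  linarith


/-- For a closed `S ⊆ ℝ` and an `S`-nonnegativity preserver `Φ` on `ℝ[X]`: for every `p`
strictly positive on `S`, the zero set of `Φ(p)` in `S` equals the zero set of `Φ(1)` in `S`;
in particular, `Φ` is an `S`-positivity preserver iff `Φ(1) > 0` on `S`. -/
theorem zero_locus_eq_and_positivity_iff_of_closed_univariate
    (S : Set ℝ) (hS : IsClosed S)
    (Φ : Polynomial ℝ →ₗ[ℝ] Polynomial ℝ)
    (hΦ : ∀ p : Polynomial ℝ,
      (∀ x ∈ S, 0 ≤ p.eval x) → ∀ x ∈ S, 0 ≤ (Φ p).eval x) :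
    (∀ p : Polynomial ℝ, (∀ x ∈ S, 0 < p.eval x) →
      {x ∈ S | (Φ p).eval x = 0} = {x ∈ S | (Φ 1).eval x = 0}) ∧
    ((∀ p : Polynomial ℝ,
        (∀ x ∈ S, 0 < p.eval x) → ∀ x ∈ S, 0 < (Φ p).eval x) ↔
      ∀ x ∈ S, 0 < (Φ 1).eval x) := by
  have hzero : ∀ p : Polynomial ℝ, (∀ x ∈ S, 0 < p.eval x) →
      {x ∈ S | (Φ p).eval x = 0} = {x ∈ S | (Φ 1).eval x = 0} := by
    intro p hp
    ext x
    refine and_congr_right fun hx => ⟨fun h => ?_, fun h => ?_⟩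
    · obtain ⟨ε, hε, hle⟩ := Polynomial.exists_pos_le_eval_of_isClosed hS hp
      have h₁ : 0 ≤ (Φ 1).eval x := hΦ 1 (by simp) x hx
      have h₂ := hΦ (p - ε • 1) (fun y hy => by simpa using hle y hy) x hx
      simp only [map_sub, map_smul, Polynomial.eval_sub, Polynomial.eval_smul, smul_eq_mul, h]
        at h₂
      nlinarith
    · exact LinearMap.apply_eq_zero_of_map_one_eq_zero_of_sq_nonneg
        (Polynomial.leval x ∘ₗ Φ)
        (fun q => hΦ (q ^ 2) (fun y _ => by simpa using sq_nonneg (q.eval y)) x hx) h p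
  refine ⟨hzero, fun h => h 1 (by simp), fun h p hp x hx => ?_⟩
  refine (hΦ p (fun y hy => (hp y hy).le) x hx).lt_of_ne' fun h₀ => (h x hx).ne' ?_
  have hmem : x ∈ {x ∈ S | (Φ p).eval x = 0} := ⟨hx, h₀⟩
  rw [hzero p hp] at hmem
  exact hmem.2
end

section
/- Let S ⊆ ℝⁿ be a nonempty connected set and let Φ : ℝ[X₁,…,Xₙ] → ℝ[X₁,…,Xₙ] be a linear map. Then Φ is an S-ellipticity preserver if and only if Φ or −Φ is an S-positivity preserver. -/
namespace MvPolynomial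

/-- A polynomial without zeros on a preconnected set has constant sign there. -/
theorem eval_pos_or_eval_neg_of_isPreconnected {σ : Type*} {S : Set (σ → ℝ)}
    (hS : IsPreconnected S) (p : MvPolynomial σ ℝ) (hp : ∀ x ∈ S, eval x p ≠ 0) :
    (∀ x ∈ S, 0 < eval x p) ∨ (∀ x ∈ S, eval x p < 0) := by
  by_contra! h
  obtain ⟨⟨a, ha, hpa⟩, b, hb, hpb⟩ := h
  obtain ⟨c, hc, hpc⟩ :=
    hS.intermediate_value ha hb (continuous_eval p).continuousOn ⟨hpa, hpb⟩
  exact hp c hc hpc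

/-- A linear map preserving nonvanishing on `S` and sending `1` to a polynomial positive on `S`
preserves positivity on `S`. -/
theorem eval_map_pos_of_preserves_ne_zero {σ : Type*} {S : Set (σ → ℝ)}
    (Φ : MvPolynomial σ ℝ →ₗ[ℝ] MvPolynomial σ ℝ)
    (hΦ : ∀ p : MvPolynomial σ ℝ, (∀ x ∈ S, eval x p ≠ 0) → ∀ x ∈ S, eval x (Φ p) ≠ 0)
    (h_one : ∀ x ∈ S, 0 < eval x (Φ 1)) (p : MvPolynomial σ ℝ) (hp : ∀ x ∈ S, 0 < eval x p) :
    ∀ x ∈ S, 0 < eval x (Φ p) := by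
  intro x hx
  by_contra! hneg
  have h1 := h_one x hx
  have ht : 0 ≤ -eval x (Φ p) / eval x (Φ 1) := div_nonneg (neg_nonneg.2 hneg) h1.le
  refine hΦ (p + (-eval x (Φ p) / eval x (Φ 1)) • 1) (fun y hy => ?_) x hx ?_
  · have := hp y hy
    simp only [map_add, smul_eval, map_one, mul_one]
    positivity
  · simp only [map_add, map_smul, smul_eval]
    field_simp
    ring

end MvPolynomial


/-- For a nonempty connected `S ⊆ ℝⁿ` and a linear map `Φ`, `Φ` is an `S`-ellipticity
preserver if and only if `Φ` or `−Φ` is an `S`-positivity preserver. -/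
theorem ellipticity_preserver_iff_pm_positivity_preserver
    (n : ℕ) (S : Set (Fin n → ℝ)) (hS : IsConnected S)
    (Φ : MvPolynomial (Fin n) ℝ →ₗ[ℝ] MvPolynomial (Fin n) ℝ) :
    (∀ p : MvPolynomial (Fin n) ℝ,
      (∀ x ∈ S, MvPolynomial.eval x p ≠ 0) → ∀ x ∈ S, MvPolynomial.eval x (Φ p) ≠ 0) ↔
    ((∀ p : MvPolynomial (Fin n) ℝ,
        (∀ x ∈ S, 0 < MvPolynomial.eval x p) → ∀ x ∈ S, 0 < MvPolynomial.eval x (Φ p)) ∨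
     (∀ p : MvPolynomial (Fin n) ℝ,
        (∀ x ∈ S, 0 < MvPolynomial.eval x p) → ∀ x ∈ S, 0 < MvPolynomial.eval x ((-Φ) p))) := by
  constructor
  · intro hΦ
    rcases MvPolynomial.eval_pos_or_eval_neg_of_isPreconnected hS.isPreconnected (Φ 1)
      (hΦ 1 (by simp)) with h | h
    · exact Or.inl (MvPolynomial.eval_map_pos_of_preserves_ne_zero Φ hΦ h)
    · refine Or.inr (MvPolynomial.eval_map_pos_of_preserves_ne_zero (-Φ) ?_ ?_)
      · simpa using hΦ
      · simpa using h
  · intro hΦ p hp x hx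
    rcases MvPolynomial.eval_pos_or_eval_neg_of_isPreconnected hS.isPreconnected p hp with h | h
    · rcases hΦ with hΦ | hΦ
      · exact (hΦ p h x hx).ne'
      · simpa using (hΦ p h x hx).ne'
    · have h' : ∀ x ∈ S, 0 < MvPolynomial.eval x (-p) := by simpa using h
      rcases hΦ with hΦ | hΦ
      · simpa using (hΦ (-p) h' x hx).ne'
      · simpa using (hΦ (-p) h' x hx).ne'
end

section
/- Every linear operator Φ : ℝ[X₁,…,Xₙ] → ℝ[X₁,…,Xₙ] is a differential operator with polynomial coefficients: there exists a unique family (q_α)_{α∈ℕⁿ} of polynomials q_α ∈ ℝ[X₁,…,Xₙ] such that Φ(p) = Σ_{α∈ℕⁿ} q_α · D^α(p) for every polynomial p (this sum has only finitely many nonzero terms for each p, since D^α(p) = 0 when |α| exceeds the degree of p). -/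
open MvPolynomial

/-- The differential operator `D^α = ∂₁^{α₁} ⋯ ∂ₙ^{αₙ}` on `ℝ[X₁,…,Xₙ]`. -/
noncomputable def Dop (n : ℕ) (α : Fin n → ℕ) :
    Module.End ℝ (MvPolynomial (Fin n) ℝ) :=
  (List.ofFn (fun i : Fin n =>
    ((MvPolynomial.pderiv i).toLinearMap : Module.End ℝ (MvPolynomial (Fin n) ℝ)) ^ (α i))).prod

/-- Iterated partial derivatives of a monomial. -/
theorem pderiv_pow_monomial {σ R : Type*} [CommSemiring R] (i : σ) (k : ℕ) (s : σ →₀ ℕ) (c : R) :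
    (((pderiv i).toLinearMap : Module.End R (MvPolynomial σ R)) ^ k) (monomial s c) =
      monomial (s - Finsupp.single i k) (c * ((s i).descFactorial k : R)) := by
  induction k with
  | zero => simp
  | succ k ih =>
    rw [pow_succ', Module.End.mul_apply, ih, Derivation.coeFn_coe,
      pderiv_monomial, Nat.descFactorial_succ, tsub_tsub, ← Finsupp.single_add]
    congr 1
    simp [mul_comm, mul_left_comm]

/-- Composing powers of pairwise distinct partial derivatives on a monomial. -/
theorem list_prod_pderiv_pow_monomial {σ R : Type*} [CommSemiring R] (α : σ → ℕ) (s : σ →₀ ℕ)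
    (l : List σ) (hl : l.Nodup) :
    (l.map fun i => ((pderiv i).toLinearMap : Module.End R (MvPolynomial σ R)) ^ α i).prod
        (monomial s 1) =
      monomial (s - (l.map fun i => Finsupp.single i (α i)).sum)
        (l.map fun i => ((s i).descFactorial (α i) : R)).prod := by
  induction l with
  | nil => simp
  | cons i l ih =>
    obtain ⟨hi, hl'⟩ := List.nodup_cons.mp hl
    have hsum : ((l.map fun j => Finsupp.single j (α j)).sum : σ →₀ ℕ) i = 0 := by
      clear ih hl hl'
      induction l with
      | nil => simp
      | cons j l ih =>
        rw [List.mem_cons, not_or] at hi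
        simp [Finsupp.single_eq_of_ne hi.1, ih hi.2]
    simp only [List.map_cons, List.prod_cons, List.sum_cons, Module.End.mul_apply]
    rw [ih hl', pderiv_pow_monomial, Finsupp.tsub_apply, hsum, tsub_zero, tsub_tsub, add_comm,
      mul_comm]

theorem Dop_monomial (n : ℕ) (α : Fin n → ℕ) (s : Fin n →₀ ℕ) :
    Dop n α (monomial s 1) =
      monomial (s - Finsupp.equivFunOnFinite.symm α)
        (∏ i, ((s i).descFactorial (α i) : ℝ)) := by
  rw [Dop, List.ofFn_eq_map, list_prod_pderiv_pow_monomial α s _ (List.nodup_finRange n),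
    ← List.ofFn_eq_map, ← List.ofFn_eq_map, List.sum_ofFn, List.prod_ofFn]
  congr 2
  ext j
  simp [Finsupp.single_apply]

theorem Dop_monomial_eq_zero {n : ℕ} {α : Fin n → ℕ} {s : Fin n →₀ ℕ} (h : ¬ α ≤ s) :
    Dop n α (monomial s 1) = 0 := by
  obtain ⟨i, hi⟩ := not_forall.mp h
  rw [Dop_monomial, Finset.prod_eq_zero (Finset.mem_univ i), monomial_zero]
  exact_mod_cast Nat.descFactorial_of_lt (not_le.mp hi)

theorem Dop_monomial_self (n : ℕ) (s : Fin n →₀ ℕ) :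
    Dop n s (monomial s 1) = C (∏ i, ((s i).factorial : ℝ)) := by
  simp [Dop_monomial, Nat.descFactorial_self]

theorem finite_support_mul_Dop {n : ℕ} (q : (Fin n → ℕ) → MvPolynomial (Fin n) ℝ)
    (p : MvPolynomial (Fin n) ℝ) : (Function.support fun α => q α * Dop n α p).Finite := by
  refine (p.support.finite_toSet.biUnion fun s _ => Set.finite_Iic (s : Fin n → ℕ)).subset ?_
  intro α hα
  by_contra h
  simp only [Set.mem_iUnion, Set.mem_Iic, Finset.mem_coe, not_exists] at h
  refine hα ?_
  simp only
  rw [p.as_sum, map_sum, Finset.sum_eq_zero, mul_zero]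
  intro s hs
  rw [← mul_one (coeff s p), ← smul_eq_mul, ← smul_monomial, map_smul,
    Dop_monomial_eq_zero (h s hs), smul_zero]

/-- The operator `p ↦ ∑ q_α D^α p`. -/
noncomputable def diffOp {n : ℕ} (q : (Fin n → ℕ) → MvPolynomial (Fin n) ℝ) :
    MvPolynomial (Fin n) ℝ →ₗ[ℝ] MvPolynomial (Fin n) ℝ where
  toFun p := ∑ᶠ α, q α * Dop n α p
  map_add' p p' := by
    simp only [map_add, mul_add]
    exact finsum_add_distrib (finite_support_mul_Dop q p) (finite_support_mul_Dop q p')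
  map_smul' c p := by
    simp only [map_smul, mul_smul_comm, RingHom.id_apply]
    exact (smul_finsum' c (finite_support_mul_Dop q p)).symm

theorem diffOp_monomial {n : ℕ} (q : (Fin n → ℕ) → MvPolynomial (Fin n) ℝ) (s : Fin n →₀ ℕ) :
    diffOp q (monomial s 1) = q s * C (∏ i, ((s i).factorial : ℝ)) +
      ∑ α ∈ Finset.Iio (s : Fin n → ℕ), q α * Dop n α (monomial s 1) := by
  have h : (Function.support fun α => q α * Dop n α (monomial s 1)) ⊆
      Finset.Iic (s : Fin n → ℕ) := by
    intro α hα
    by_contra hs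
    exact hα (by simp [Dop_monomial_eq_zero (by simpa using hs)])
  rw [← Dop_monomial_self, diffOp, LinearMap.coe_mk, AddHom.coe_mk,
    finsum_eq_sum_of_support_subset _ h, ← Finset.Iio_insert, Finset.sum_insert (by simp)]

theorem diffOp_eq_iff {n : ℕ} (Φ : MvPolynomial (Fin n) ℝ →ₗ[ℝ] MvPolynomial (Fin n) ℝ)
    (q : (Fin n → ℕ) → MvPolynomial (Fin n) ℝ) :
    Φ = diffOp q ↔ ∀ β : Fin n → ℕ, q β = C (∏ i, ((β i).factorial : ℝ))⁻¹ *
      (Φ (monomial (Finsupp.equivFunOnFinite.symm β) 1) - ∑ α ∈ Finset.Iio β,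
        q α * Dop n α (monomial (Finsupp.equivFunOnFinite.symm β) 1)) := by
  have hC (β : Fin n → ℕ) : (C (∏ i, ((β i).factorial : ℝ))⁻¹ : MvPolynomial (Fin n) ℝ) *
      C (∏ i, ((β i).factorial : ℝ)) = 1 := by
    rw [← C_mul, inv_mul_cancel₀, C_1]
    exact Finset.prod_ne_zero_iff.mpr fun i _ => Nat.cast_ne_zero.mpr (Nat.factorial_ne_zero _)
  constructor
  · rintro rfl β
    rw [diffOp_monomial, Finsupp.coe_equivFunOnFinite_symm, add_sub_cancel_right]
    linear_combination -q β * hC β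
  · intro h
    refine (basisMonomials (Fin n) ℝ).ext fun s => ?_
    rw [coe_basisMonomials, diffOp_monomial, h s, Finsupp.equivFunOnFinite_symm_coe]
    linear_combination (-Φ (monomial s 1) + ∑ α ∈ Finset.Iio (s : Fin n → ℕ),
      q α * Dop n α (monomial s 1)) * hC s

/-- Every linear operator on `ℝ[X₁,…,Xₙ]` is, in a unique way, a differential operator
with polynomial coefficients: `Φ(p) = Σ_α q_α · D^α(p)` (a finite sum for each `p`). -/
theorem exists_unique_polynomial_coefficients
    (n : ℕ) (Φ : MvPolynomial (Fin n) ℝ →ₗ[ℝ] MvPolynomial (Fin n) ℝ) :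
    ∃! q : (Fin n → ℕ) → MvPolynomial (Fin n) ℝ,
      ∀ p : MvPolynomial (Fin n) ℝ, Φ p = ∑ᶠ α : Fin n → ℕ, q α * Dop n α p := by
  have key (q : (Fin n → ℕ) → MvPolynomial (Fin n) ℝ) :
      (∀ p, Φ p = ∑ᶠ α : Fin n → ℕ, q α * Dop n α p) ↔ Φ = diffOp q :=
    (LinearMap.ext_iff (f := Φ) (g := diffOp q)).symm
  simp only [key, diffOp_eq_iff]
  have wf : WellFounded ((· < ·) : (Fin n → ℕ) → (Fin n → ℕ) → Prop) := wellFounded_lt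
  refine ⟨wf.fix fun β q => C (∏ i, ((β i).factorial : ℝ))⁻¹ *
    (Φ (monomial (Finsupp.equivFunOnFinite.symm β) 1) - ∑ α ∈ (Finset.Iio β).attach,
      q α (Finset.mem_Iio.mp α.2) *
        Dop n α (monomial (Finsupp.equivFunOnFinite.symm β) 1)), fun β => ?_, fun q hq => ?_⟩
  · rw [wf.fix_eq, ← Finset.sum_attach (Finset.Iio β)]
  · funext β
    induction β using wf.induction with
    | _ β ih =>
    rw [hq β, wf.fix_eq, ← Finset.sum_attach (Finset.Iio β)]
    congr! 4 with α
    exact ih α (Finset.mem_Iio.mp α.2)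
end

section
/- The linear operator Φ : ℝ[X] → ℝ[X] defined by Φ(p) = p(X+1) is a [2,∞)-positivity preserver, yet there exists no nonnegative Borel measure μ on [2,∞) such that all monomials are μ-integrable and ∫_{[2,∞)} x^i dμ(x) = 1 for every i ∈ ℕ. (Since Φ = Σ_{i∈ℕ} (1/i!) D^i, this shows that the conclusion of the moment-sequence lemma fails without the hypothesis 0 ∈ S.) -/
open MeasureTheory Polynomial

/-- The operator `p ↦ p(X+1)` preserves positivity on `S = [2,∞)`, but there is no
nonnegative Borel measure `μ` on `[2,∞)` whose `i`-th moment is `1` for every `i ∈ ℕ`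
(which the moment-sequence lemma would produce if `0 ∈ S` held). -/
theorem shift_operator_positivity_preserver_but_not_moment_sequence :
    (∀ p : Polynomial ℝ,
      (∀ x ∈ Set.Ici (2 : ℝ), 0 < p.eval x) →
        ∀ x ∈ Set.Ici (2 : ℝ), 0 < (p.comp (Polynomial.X + 1)).eval x) ∧
    ¬ ∃ μ : Measure ℝ,
        μ (Set.Ici (2 : ℝ))ᶜ = 0 ∧
        (∀ i : ℕ, Integrable (fun x : ℝ => x ^ i) μ) ∧
        (∀ i : ℕ, ∫ x, x ^ i ∂μ = 1) := by
  refine ⟨fun p hp x hx => ?_, ?_⟩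
  · have hx' : x + 1 ∈ Set.Ici (2 : ℝ) := by
      simp only [Set.mem_Ici] at hx ⊢
      linarith
    simpa [eval_comp] using hp (x + 1) hx'
  · rintro ⟨μ, hμ, hint, hmom⟩
    have hae : ∀ᵐ x ∂μ, x ∈ Set.Ici (2 : ℝ) := hμ
    have hle : ∫ x, 2 * x ^ 0 ∂μ ≤ ∫ x, x ^ 1 ∂μ := by
      refine integral_mono_ae ((hint 0).const_mul 2) (hint 1) ?_
      filter_upwards [hae] with x hx
      simpa using hx
    rw [integral_const_mul, hmom 0, hmom 1] at hle
    norm_num at hle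
end

section
/- Let S ⊆ ℝⁿ, let (q_α)_{α∈ℕⁿ} be a family of polynomials in ℝ[X₁,…,Xₙ], and let Φ = Σ_{α∈ℕⁿ} q_α D^α be the corresponding differential operator with polynomial coefficients (the sum applied to any polynomial is finite). For a ∈ ℝⁿ, let Φ_a = Σ_{α∈ℕⁿ} q_α(a) D^α be the constant-coefficient operator obtained by evaluating the coefficients at a. If Φ_a is an S-nonnegativity preserver for every a ∈ S, then Φ is an S-nonnegativity preserver. -/
open MvPolynomial

namespace MvPolynomial

variable {σ R : Type*} [CommSemiring R]

theorem degreeOf_pderiv_le (i j : σ) (p : MvPolynomial σ R) :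
    degreeOf i (pderiv j p) ≤ degreeOf i p := by
  refine degreeOf_le_iff.2 fun m hm => ?_
  rw [mem_support_iff, coeff_pderiv] at hm
  have h := monomial_le_degreeOf i (mem_support_iff.2 (left_ne_zero_of_mul hm))
  exact le_trans (by simp) h

theorem degreeOf_pderiv_self_le (i : σ) (p : MvPolynomial σ R) :
    degreeOf i (pderiv i p) ≤ degreeOf i p - 1 := by
  refine degreeOf_le_iff.2 fun m hm => ?_
  rw [mem_support_iff, coeff_pderiv] at hm
  have h := monomial_le_degreeOf i (mem_support_iff.2 (left_ne_zero_of_mul hm))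
  exact Nat.le_sub_one_of_lt (by simpa [Nat.succ_le_iff] using h)

theorem pderiv_eq_zero_of_degreeOf_eq_zero {i : σ} {p : MvPolynomial σ R}
    (h : degreeOf i p = 0) : pderiv i p = 0 := by
  classical
  refine pderiv_eq_zero_of_notMem_vars fun hi => ?_
  rw [vars_def, Multiset.mem_toFinset, ← Multiset.count_pos, ← degreeOf_def] at hi
  exact hi.ne' h

theorem degreeOf_pderiv_pow_le (i j : σ) (k : ℕ) (p : MvPolynomial σ R) :
    degreeOf i (((pderiv j).toLinearMap ^ k : Module.End R (MvPolynomial σ R)) p)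
      ≤ degreeOf i p := by
  induction k generalizing p with
  | zero => simp
  | succ k ih =>
    rw [pow_succ, Module.End.mul_apply]
    exact (ih _).trans (degreeOf_pderiv_le i j p)

theorem pderiv_pow_eq_zero_of_degreeOf_lt {i : σ} {k : ℕ} {p : MvPolynomial σ R}
    (h : degreeOf i p < k) :
    ((pderiv i).toLinearMap ^ k : Module.End R (MvPolynomial σ R)) p = 0 := by
  induction k generalizing p with
  | zero => exact absurd h (Nat.not_lt_zero _)
  | succ k ih =>
    rw [pow_succ, Module.End.mul_apply, Derivation.coeFn_coe]
    rcases Nat.eq_zero_or_pos (degreeOf i p) with h0 | h0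
    · rw [pderiv_eq_zero_of_degreeOf_eq_zero h0, map_zero]
    · have := degreeOf_pderiv_self_le i p
      exact ih (by omega)

end MvPolynomial

theorem Module.End.list_prod_apply_eq_zero {R M : Type*} [Semiring R] [AddCommMonoid M]
    [Module R M] {P : M → Prop} {L : List (Module.End R M)}
    (hP : ∀ f ∈ L, ∀ x, P x → P (f x)) {f : Module.End R M} (hf : f ∈ L)
    (hf0 : ∀ x, P x → f x = 0) {x : M} (hx : P x) : L.prod x = 0 := by
  have hprod : ∀ L' : List (Module.End R M), (∀ g ∈ L', ∀ y, P y → P (g y)) → P (L'.prod x) := by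
    intro L'
    induction L' with
    | nil => simpa using hx
    | cons g L' ih =>
      intro h
      rw [List.prod_cons, Module.End.mul_apply]
      exact h g (by simp) _ (ih fun g' hg' => h g' (by simp [hg']))
  obtain ⟨L₁, L₂, rfl⟩ := List.append_of_mem hf
  rw [List.prod_append, List.prod_cons, Module.End.mul_apply, Module.End.mul_apply,
    hf0 _ (hprod L₂ fun g hg => hP g (by simp [hg])), map_zero]

theorem Dop_eq_zero_of_degreeOf_lt {n : ℕ} {α : Fin n → ℕ} {p : MvPolynomial (Fin n) ℝ}
    {i : Fin n} (h : degreeOf i p < α i) : Dop n α p = 0 := by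
  refine Module.End.list_prod_apply_eq_zero (P := fun p => degreeOf i p < α i)
    (fun f hf x hx => ?_) (List.mem_ofFn.2 ⟨i, rfl⟩)
    (fun x hx => pderiv_pow_eq_zero_of_degreeOf_lt hx) h
  obtain ⟨j, rfl⟩ := List.mem_ofFn.1 hf
  exact (degreeOf_pderiv_pow_le i j (α j) x).trans_lt hx

theorem finite_setOf_Dop_ne_zero {n : ℕ} (p : MvPolynomial (Fin n) ℝ) :
    {α | Dop n α p ≠ 0}.Finite := by
  refine (Set.finite_Iic fun i => degreeOf i p).subset fun α hα i => ?_
  by_contra! hi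
  exact hα (Dop_eq_zero_of_degreeOf_lt hi)

theorem eval_finsum_mul_Dop {n : ℕ} (q : (Fin n → ℕ) → MvPolynomial (Fin n) ℝ)
    (p : MvPolynomial (Fin n) ℝ) (x : Fin n → ℝ) :
    eval x (∑ᶠ α : Fin n → ℕ, q α * Dop n α p) =
      eval x (∑ᶠ α : Fin n → ℕ, eval x (q α) • Dop n α p) := by
  have hfin := finite_setOf_Dop_ne_zero p
  rw [finsum_eq_sum_of_support_subset (s := hfin.toFinset) _ fun α hα => by
      simpa using right_ne_zero_of_mul hα,
    finsum_eq_sum_of_support_subset (s := hfin.toFinset) _ fun α hα => by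
      simpa using (smul_ne_zero_iff.1 hα).2]
  simp

/-- Let `Φ = Σ_α q_α D^α` be a differential operator with polynomial coefficients, and for
`a ∈ ℝⁿ` let `Φ_a = Σ_α q_α(a) D^α`. If `Φ_a` is an `S`-nonnegativity preserver for every
`a ∈ S`, then `Φ` is an `S`-nonnegativity preserver. -/
theorem nonnegativity_preserving_of_pointwise_evaluations
    (n : ℕ) (S : Set (Fin n → ℝ)) (q : (Fin n → ℕ) → MvPolynomial (Fin n) ℝ)
    (hA : ∀ a ∈ S, ∀ p : MvPolynomial (Fin n) ℝ,
      (∀ x ∈ S, 0 ≤ MvPolynomial.eval x p) →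
        ∀ x ∈ S, 0 ≤ MvPolynomial.eval x
          (∑ᶠ α : Fin n → ℕ, MvPolynomial.eval a (q α) • Dop n α p)) :
    ∀ p : MvPolynomial (Fin n) ℝ,
      (∀ x ∈ S, 0 ≤ MvPolynomial.eval x p) →
        ∀ x ∈ S, 0 ≤ MvPolynomial.eval x (∑ᶠ α : Fin n → ℕ, q α * Dop n α p) := by
  intro p hp x hx
  rw [eval_finsum_mul_Dop]
  exact hA x hx p hp x hx
end

section
/- Let S ⊆ ℝⁿ be closed and let Φ : ℝ[X₁,…,Xₙ] → ℝ[X₁,…,Xₙ] be an S-nonnegativity preserver. Then Φ has an adjoint map: there exists a map T : ℳ₊(S) → ℳ₊(S) such that ∫_S Φ(p) dμ = ∫_S p d(Tμ) for all polynomials p ∈ ℝ[X₁,…,Xₙ] and all μ ∈ ℳ₊(S). -/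
open MvPolynomial MeasureTheory

/-- `μ ∈ ℳ₊(S)`: a nonnegative Borel measure on `S` (i.e. vanishing outside `S`) for which
every polynomial is integrable. -/
def MemMPlus (n : ℕ) (S : Set (Fin n → ℝ)) (μ : Measure (Fin n → ℝ)) : Prop :=
  μ Sᶜ = 0 ∧ ∀ p : MvPolynomial (Fin n) ℝ, Integrable (fun x => MvPolynomial.eval x p) μ

open Filter Topology CompactlySupported

/-- The polynomial `X₁² + ⋯ + Xₙ²`. -/
noncomputable def sumSqPolynomial (n : ℕ) : MvPolynomial (Fin n) ℝ := ∑ i, X i ^ 2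

lemma eval_sumSqPolynomial {n : ℕ} (x : Fin n → ℝ) :
    eval x (sumSqPolynomial n) = ∑ i, x i ^ 2 := by
  simp [sumSqPolynomial]

lemma eval_sumSqPolynomial_nonneg {n : ℕ} (x : Fin n → ℝ) :
    0 ≤ eval x (sumSqPolynomial n) := by
  rw [eval_sumSqPolynomial]
  positivity

lemma isCompact_eval_sumSqPolynomial_le {n : ℕ} {S : Set (Fin n → ℝ)} (hS : IsClosed S)
    (c : ℝ) : IsCompact {x : S | eval (x : Fin n → ℝ) (sumSqPolynomial n) ≤ c} := by
  have hK : IsCompact {x : Fin n → ℝ | eval x (sumSqPolynomial n) ≤ c} := by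
    refine Metric.isCompact_of_isClosed_isBounded
      (isClosed_le (MvPolynomial.continuous_eval _) continuous_const) ?_
    refine (Metric.isBounded_closedBall (x := (0 : Fin n → ℝ)) (r := √c)).subset fun x hx => ?_
    rw [mem_closedBall_zero_iff, pi_norm_le_iff_of_nonneg (Real.sqrt_nonneg c)]
    intro i
    refine Real.abs_le_sqrt (le_trans ?_ hx)
    rw [eval_sumSqPolynomial]
    exact Finset.single_le_sum (f := fun i => x i ^ 2) (fun _ _ => sq_nonneg _)
      (Finset.mem_univ i)
  exact hS.isClosedEmbedding_subtypeVal.isCompact_preimage hK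

/-- The cut-off function `max 0 (1 - ‖x‖² / (k + 1))`, with the Euclidean norm. -/
noncomputable def polynomialCutoff {n : ℕ} (k : ℕ) (x : Fin n → ℝ) : ℝ :=
  max 0 (1 - eval x (sumSqPolynomial n) / (k + 1))

lemma polynomialCutoff_nonneg {n : ℕ} (k : ℕ) (x : Fin n → ℝ) : 0 ≤ polynomialCutoff k x :=
  le_max_left _ _

lemma polynomialCutoff_le_one {n : ℕ} (k : ℕ) (x : Fin n → ℝ) : polynomialCutoff k x ≤ 1 :=
  max_le zero_le_one (sub_le_self _ (div_nonneg (eval_sumSqPolynomial_nonneg x) (by positivity)))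

lemma monotone_polynomialCutoff {n : ℕ} (x : Fin n → ℝ) :
    Monotone fun k => polynomialCutoff k x := by
  intro k l hkl
  have := eval_sumSqPolynomial_nonneg x
  unfold polynomialCutoff
  dsimp only
  gcongr

lemma tendsto_polynomialCutoff {n : ℕ} (x : Fin n → ℝ) :
    Tendsto (fun k => polynomialCutoff k x) atTop (𝓝 1) := by
  have h : Tendsto (fun k : ℕ => eval x (sumSqPolynomial n) * (1 / ((k : ℝ) + 1))) atTop
      (𝓝 (eval x (sumSqPolynomial n) * 0)) :=
    tendsto_one_div_add_atTop_nhds_zero_nat.const_mul _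
  have h' := (tendsto_const_nhds (x := (0 : ℝ))).max ((tendsto_const_nhds (x := (1 : ℝ))).sub h)
  simpa [polynomialCutoff, div_eq_mul_inv] using h'

lemma continuous_polynomialCutoff {n : ℕ} (k : ℕ) :
    Continuous (polynomialCutoff k : (Fin n → ℝ) → ℝ) := by
  unfold polynomialCutoff
  exact continuous_const.max
    (continuous_const.sub ((MvPolynomial.continuous_eval _).div_const _))

lemma polynomialCutoff_eq_zero {n : ℕ} {k : ℕ} {x : Fin n → ℝ}
    (hx : (k : ℝ) + 1 < eval x (sumSqPolynomial n)) : polynomialCutoff k x = 0 := by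
  have h : 1 ≤ eval x (sumSqPolynomial n) / ((k : ℝ) + 1) :=
    (one_le_div (by positivity)).mpr hx.le
  exact max_eq_left (by linarith)

lemma continuous_eval_mul_polynomialCutoff {n : ℕ} (S : Set (Fin n → ℝ))
    (q : MvPolynomial (Fin n) ℝ) (k : ℕ) :
    Continuous fun x : S => eval (x : Fin n → ℝ) q * polynomialCutoff k (x : Fin n → ℝ) := by
  have h : Continuous fun x : Fin n → ℝ => eval x q * polynomialCutoff k x :=
    (MvPolynomial.continuous_eval q).mul (continuous_polynomialCutoff k)
  exact h.comp continuous_subtype_val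

lemma hasCompactSupport_eval_mul_polynomialCutoff {n : ℕ} {S : Set (Fin n → ℝ)}
    (hS : IsClosed S) (q : MvPolynomial (Fin n) ℝ) (k : ℕ) :
    HasCompactSupport
      fun x : S => eval (x : Fin n → ℝ) q * polynomialCutoff k (x : Fin n → ℝ) := by
  refine HasCompactSupport.intro
    (isCompact_eval_sumSqPolynomial_le hS ((k : ℝ) + 1)) fun x hx => ?_
  rw [polynomialCutoff_eq_zero (not_le.mp hx), mul_zero]

/-- A polynomial multiplied by the cut-off function, as a compactly supported function on a
closed set. -/
noncomputable def truncatedPolynomial {n : ℕ} {S : Set (Fin n → ℝ)} (hS : IsClosed S)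
    (q : MvPolynomial (Fin n) ℝ) (k : ℕ) : C_c(S, ℝ) where
  toFun := fun x : S => eval (x : Fin n → ℝ) q * polynomialCutoff k (x : Fin n → ℝ)
  continuous_toFun := continuous_eval_mul_polynomialCutoff S q k
  hasCompactSupport' := hasCompactSupport_eval_mul_polynomialCutoff hS q k

lemma truncatedPolynomial_apply {n : ℕ} {S : Set (Fin n → ℝ)} (hS : IsClosed S)
    (q : MvPolynomial (Fin n) ℝ) (k : ℕ) (x : S) :
    truncatedPolynomial hS q k x = eval (x : Fin n → ℝ) q * polynomialCutoff k (x : Fin n → ℝ) :=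
  rfl

/-- A linear functional on polynomials that is nonnegative on `𝒩(S)` extends, together with its
positivity, to sums of polynomials and compactly supported functions on `S`. -/
lemma exists_positive_extension {n : ℕ} {S : Set (Fin n → ℝ)}
    (L : MvPolynomial (Fin n) ℝ →ₗ[ℝ] ℝ)
    (hL : ∀ p, (∀ x ∈ S, 0 ≤ eval x p) → 0 ≤ L p) :
    ∃ Λ : C_c(S, ℝ) →ₗ[ℝ] ℝ, ∀ (p : MvPolynomial (Fin n) ℝ) (f : C_c(S, ℝ)),
      (∀ x : S, 0 ≤ eval (x : Fin n → ℝ) p + f x) → 0 ≤ L p + Λ f := by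
  let s : PointedCone ℝ (MvPolynomial (Fin n) ℝ × C_c(S, ℝ)) :=
    { carrier := {a | ∀ x : S, 0 ≤ eval (x : Fin n → ℝ) a.1 + a.2 x}
      zero_mem' := fun x => by simp
      add_mem' := fun {a b} ha hb x => by
        have h1 := ha x
        have h2 := hb x
        simp only [Prod.fst_add, Prod.snd_add, map_add, CompactlySupportedContinuousMap.add_apply]
        linarith
      smul_mem' := fun c a ha x => by
        have h := mul_nonneg c.2 (ha x)
        have e : eval (x : Fin n → ℝ) (c • a).1 + (c • a).2 x
            = (c : ℝ) * (eval (x : Fin n → ℝ) a.1 + a.2 x) := by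
          change eval (x : Fin n → ℝ) ((c : ℝ) • a.1) + (c : ℝ) * a.2 x = _
          rw [smul_eval]
          ring
        rw [e]
        exact h }
  let F : (MvPolynomial (Fin n) ℝ × C_c(S, ℝ)) →ₗ.[ℝ] ℝ :=
    { domain := LinearMap.ker (LinearMap.snd ℝ (MvPolynomial (Fin n) ℝ) C_c(S, ℝ))
      toFun := (L ∘ₗ LinearMap.fst ℝ _ _) ∘ₗ Submodule.subtype _ }
  have hFs : ∀ a : F.domain, (a : MvPolynomial (Fin n) ℝ × C_c(S, ℝ)) ∈ s → 0 ≤ F a := by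
    rintro ⟨⟨p, f⟩, hf⟩ ha
    obtain rfl : f = 0 := hf
    refine hL p fun x hx => ?_
    simpa using ha ⟨x, hx⟩
  have hdense : ∀ a, ∃ b : F.domain, (b : MvPolynomial (Fin n) ℝ × C_c(S, ℝ)) + a ∈ s := by
    rintro ⟨q, f⟩
    obtain ⟨c, hc⟩ := f.hasCompactSupport.exists_bound_of_continuous f.continuous
    refine ⟨⟨(C c - q, 0), rfl⟩, fun x => ?_⟩
    have h := neg_le_of_abs_le (hc x)
    simp only [Prod.mk_add_mk, sub_add_cancel, eval_C, zero_add]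
    linarith
  obtain ⟨g, hgF, hgs⟩ := riesz_extension s F hFs hdense
  refine ⟨g ∘ₗ LinearMap.inr ℝ _ _, fun p f hpf => ?_⟩
  have h1 : g (p, 0) = L p := hgF ⟨(p, 0), rfl⟩
  have h2 : (p, f) = ((p, 0) : MvPolynomial (Fin n) ℝ × C_c(S, ℝ)) + (0, f) := by simp
  have h3 := hgs (p, f) hpf
  rw [h2, map_add, h1] at h3
  exact h3

/-- **Haviland's theorem**: a linear functional on polynomials that is nonnegative on `𝒩(S)`, for
`S` closed, is the integral against a measure on `S`. -/
theorem exists_measure_of_nonneg {n : ℕ} {S : Set (Fin n → ℝ)} (hS : IsClosed S)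
    (L : MvPolynomial (Fin n) ℝ →ₗ[ℝ] ℝ)
    (hL : ∀ p, (∀ x ∈ S, 0 ≤ eval x p) → 0 ≤ L p) :
    ∃ ν : Measure (Fin n → ℝ), MemMPlus n S ν ∧ ∀ p, L p = ∫ x, eval x p ∂ν := by
  obtain ⟨Λ, hΛ⟩ := exists_positive_extension L hL
  have : LocallyCompactSpace S := hS.isClosedEmbedding_subtypeVal.locallyCompactSpace
  let Λ' : C_c(S, ℝ) →ₚ[ℝ] ℝ := PositiveLinearMap.mk₀ Λ fun f hf => by
    simpa using hΛ 0 f fun x => by simpa using hf x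
  let ν : Measure S := RealRMK.rieszMeasure Λ'
  have hν : ∀ f : C_c(S, ℝ), ∫ x, f x ∂ν = Λ f := RealRMK.integral_rieszMeasure Λ'
  have hlim : ∀ q : MvPolynomial (Fin n) ℝ, (∀ x ∈ S, 0 ≤ eval x q) →
      Tendsto (fun k => Λ (truncatedPolynomial hS q k)) atTop (𝓝 (L q)) := by
    intro q hq
    have hlow : Tendsto (fun k : ℕ => L q - (1 / ((k : ℝ) + 1)) * L (q * sumSqPolynomial n)) atTop
        (𝓝 (L q)) := by
      simpa using (tendsto_const_nhds (x := L q)).sub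
        (tendsto_one_div_add_atTop_nhds_zero_nat.mul_const (L (q * sumSqPolynomial n)))
    refine tendsto_of_tendsto_of_tendsto_of_le_of_le hlow tendsto_const_nhds
      (fun k => ?_) (fun k => ?_)
    · have h := hΛ ((1 / ((k : ℝ) + 1)) • (q * sumSqPolynomial n) - q)
        (truncatedPolynomial hS q k) fun x => by
          rw [truncatedPolynomial_apply, map_sub, smul_eval, map_mul]
          have h1 : 1 - eval (x : Fin n → ℝ) (sumSqPolynomial n) / ((k : ℝ) + 1)
            ≤ polynomialCutoff k (x : Fin n → ℝ) := le_max_right _ _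
          have h2 := mul_le_mul_of_nonneg_left h1 (hq x x.2)
          have h3 : eval (x : Fin n → ℝ) q
              * (1 - eval (x : Fin n → ℝ) (sumSqPolynomial n) / ((k : ℝ) + 1))
              = eval (x : Fin n → ℝ) q - 1 / ((k : ℝ) + 1)
                * (eval (x : Fin n → ℝ) q * eval (x : Fin n → ℝ) (sumSqPolynomial n)) := by ring
          linarith
      rw [map_sub, map_smul, smul_eq_mul] at h
      linarith
    · have h := hΛ q (-truncatedPolynomial hS q k) fun x => by
        rw [CompactlySupportedContinuousMap.neg_apply, truncatedPolynomial_apply]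
        have := mul_le_mul_of_nonneg_left (polynomialCutoff_le_one k (x : Fin n → ℝ)) (hq x x.2)
        linarith
      rw [map_neg] at h
      linarith
  have hcont : ∀ p : MvPolynomial (Fin n) ℝ, Continuous fun x : S => eval (x : Fin n → ℝ) p :=
    fun p => (MvPolynomial.continuous_eval p).comp continuous_subtype_val
  have hnonneg : ∀ q : MvPolynomial (Fin n) ℝ, (∀ x ∈ S, 0 ≤ eval x q) →
      Integrable (fun x : S => eval (x : Fin n → ℝ) q) ν ∧
        L q = ∫ x : S, eval (x : Fin n → ℝ) q ∂ν := by
    intro q hq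
    have hq0 : 0 ≤ᵐ[ν] fun x : S => eval (x : Fin n → ℝ) q := ae_of_all _ fun x => hq x x.2
    have hmeas : AEStronglyMeasurable (fun x : S => eval (x : Fin n → ℝ) q) ν :=
      (hcont q).measurable.aestronglyMeasurable
    have h1 : Tendsto (fun k => ∫⁻ x, ENNReal.ofReal (truncatedPolynomial hS q k x) ∂ν) atTop
        (𝓝 (∫⁻ x : S, ENNReal.ofReal (eval (x : Fin n → ℝ) q) ∂ν)) := by
      refine lintegral_tendsto_of_tendsto_of_monotone
        (fun k => (truncatedPolynomial hS q k).continuous.measurable.ennreal_ofReal.aemeasurable)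
        (ae_of_all _ fun x k l hkl => ?_) (ae_of_all _ fun x => ?_)
      · exact ENNReal.ofReal_le_ofReal
          (mul_le_mul_of_nonneg_left (monotone_polynomialCutoff _ hkl) (hq x x.2))
      · refine ENNReal.tendsto_ofReal ?_
        simpa [truncatedPolynomial_apply] using
          (tendsto_polynomialCutoff (x : Fin n → ℝ)).const_mul (eval (x : Fin n → ℝ) q)
    have h2 : ∀ k, ∫⁻ x, ENNReal.ofReal (truncatedPolynomial hS q k x) ∂ν
        = ENNReal.ofReal (Λ (truncatedPolynomial hS q k)) := fun k => by
      have hint : Integrable (fun x => truncatedPolynomial hS q k x) ν :=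
        (truncatedPolynomial hS q k).continuous.integrable_of_hasCompactSupport
          (truncatedPolynomial hS q k).hasCompactSupport
      rw [← hν, ofReal_integral_eq_lintegral_ofReal hint
        (ae_of_all _ fun x => mul_nonneg (hq x x.2) (polynomialCutoff_nonneg k _))]
    simp only [h2] at h1
    have h3 : ∫⁻ x : S, ENNReal.ofReal (eval (x : Fin n → ℝ) q) ∂ν = ENNReal.ofReal (L q) :=
      tendsto_nhds_unique h1 (ENNReal.tendsto_ofReal (hlim q hq))
    refine ⟨⟨hmeas, (hasFiniteIntegral_iff_ofReal hq0).mpr (h3 ▸ ENNReal.ofReal_lt_top)⟩, ?_⟩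
    rw [integral_eq_lintegral_of_nonneg_ae hq0 hmeas, h3, ENNReal.toReal_ofReal (hL q hq)]
  have hall : ∀ p : MvPolynomial (Fin n) ℝ,
      Integrable (fun x : S => eval (x : Fin n → ℝ) p) ν ∧
        L p = ∫ x : S, eval (x : Fin n → ℝ) p ∂ν := by
    intro p
    obtain ⟨i1, e1⟩ := hnonneg ((p + 1) ^ 2) fun x _ => by rw [map_pow]; positivity
    obtain ⟨i2, e2⟩ := hnonneg ((p - 1) ^ 2) fun x _ => by rw [map_pow]; positivity
    have hp : p = (1 / 4 : ℝ) • ((p + 1) ^ 2 - (p - 1) ^ 2) := by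
      have : (p + 1) ^ 2 - (p - 1) ^ 2 = (4 : ℝ) • p := by
        rw [smul_eq_C_mul, map_ofNat]
        ring
      rw [this, smul_smul]
      norm_num
    have hfun : (fun x : S => eval (x : Fin n → ℝ) p) = fun x : S => (1 / 4 : ℝ)
        * (eval (x : Fin n → ℝ) ((p + 1) ^ 2) - eval (x : Fin n → ℝ) ((p - 1) ^ 2)) := by
      funext x
      simp only [map_pow, map_add, map_sub, map_one]
      ring
    refine ⟨hfun ▸ (i1.sub i2).const_mul _, ?_⟩
    rw [hfun, integral_const_mul, integral_sub i1 i2, ← e1, ← e2, ← map_sub, ← smul_eq_mul,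
      ← map_smul, ← hp]
  have hemb : MeasurableEmbedding (Subtype.val : S → Fin n → ℝ) :=
    MeasurableEmbedding.subtype_coe hS.measurableSet
  refine ⟨ν.map Subtype.val, ⟨?_, fun p => hemb.integrable_map_iff.mpr (hall p).1⟩, fun p => ?_⟩
  · rw [hemb.map_apply]
    simp
  · rw [hemb.integral_map]
    exact (hall p).2

/-- Every `S`-nonnegativity preserver on a closed set `S` has an adjoint map
`T : ℳ₊(S) → ℳ₊(S)` with `∫ Φ(p) dμ = ∫ p d(Tμ)` for all `p` and `μ`. -/
theorem exists_adjoint_map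
    (n : ℕ) (S : Set (Fin n → ℝ)) (hS : IsClosed S)
    (Φ : MvPolynomial (Fin n) ℝ →ₗ[ℝ] MvPolynomial (Fin n) ℝ)
    (hΦ : ∀ p : MvPolynomial (Fin n) ℝ,
      (∀ x ∈ S, 0 ≤ MvPolynomial.eval x p) → ∀ x ∈ S, 0 ≤ MvPolynomial.eval x (Φ p)) :
    ∃ T : Measure (Fin n → ℝ) → Measure (Fin n → ℝ),
      ∀ μ : Measure (Fin n → ℝ), MemMPlus n S μ →
        MemMPlus n S (T μ) ∧
        ∀ p : MvPolynomial (Fin n) ℝ,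
          ∫ x, MvPolynomial.eval x (Φ p) ∂μ = ∫ x, MvPolynomial.eval x p ∂(T μ) := by
  let L (μ : Measure (Fin n → ℝ)) (hμ : MemMPlus n S μ) : MvPolynomial (Fin n) ℝ →ₗ[ℝ] ℝ :=
    { toFun := fun p => ∫ x, eval x (Φ p) ∂μ
      map_add' := fun p q => by
        simp only [map_add]
        exact integral_add (hμ.2 _) (hμ.2 _)
      map_smul' := fun c p => by
        simp only [map_smul, smul_eval, RingHom.id_apply, smul_eq_mul]
        exact integral_const_mul _ _ }
  have hT : ∀ μ : Measure (Fin n → ℝ), ∃ ν : Measure (Fin n → ℝ), MemMPlus n S μ →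
      MemMPlus n S ν ∧ ∀ p : MvPolynomial (Fin n) ℝ,
        ∫ x, eval x (Φ p) ∂μ = ∫ x, eval x p ∂ν := by
    intro μ
    by_cases hμ : MemMPlus n S μ
    · have hae : ∀ᵐ x ∂μ, x ∈ S := hμ.1
      obtain ⟨ν, hν⟩ := exists_measure_of_nonneg hS (L μ hμ) fun p hp =>
        integral_nonneg_of_ae (hae.mono fun x hx => hΦ p hp x hx)
      exact ⟨ν, fun _ => hν⟩
    · exact ⟨0, fun h => absurd h hμ⟩
  choose T hT using hT
  exact ⟨T, hT⟩
end

section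
/- Let S ⊆ ℝⁿ be closed and let Φ : ℝ[X₁,…,Xₙ] → ℝ[X₁,…,Xₙ] be a linear map. Then Φ is an S-nonnegativity preserver if and only if for every x ∈ S there exists a nonnegative Borel measure μ_x on S such that every polynomial is μ_x-integrable and Φ(p)(x) = ∫_S p dμ_x for all polynomials p. -/
open MvPolynomial MeasureTheory
open Filter Topology CompactlySupported

namespace Haviland

variable {n : ℕ} {S : Set (Fin n → ℝ)}

/-- The evaluation of a polynomial as a continuous function on `S`. -/
noncomputable def evalOn (S : Set (Fin n → ℝ)) (p : MvPolynomial (Fin n) ℝ) : C(S, ℝ) where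
  toFun x := eval (x : Fin n → ℝ) p
  continuous_toFun := p.continuous_eval.comp continuous_subtype_val

@[simp] lemma evalOn_apply (p : MvPolynomial (Fin n) ℝ) (x : S) :
    evalOn S p x = eval (x : Fin n → ℝ) p := rfl

/-- The product of a compactly supported function on `S` with a polynomial. -/
noncomputable def polyMul (p : MvPolynomial (Fin n) ℝ) (f : C_c(S, ℝ)) : C_c(S, ℝ) where
  toContinuousMap := evalOn S p * f.toContinuousMap
  hasCompactSupport' := f.hasCompactSupport.mul_left

@[simp] lemma polyMul_apply (p : MvPolynomial (Fin n) ℝ) (f : C_c(S, ℝ)) (x : S) :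
    polyMul p f x = eval (x : Fin n → ℝ) p * f x := rfl

/-- The pairs `(p, f)` for which `p + f` is nonnegative on `S`. -/
def nonnegCone (S : Set (Fin n → ℝ)) :
    PointedCone ℝ (MvPolynomial (Fin n) ℝ × C_c(S, ℝ)) where
  carrier := {z | ∀ x : S, 0 ≤ eval (x : Fin n → ℝ) z.1 + z.2 x}
  zero_mem' := by simp
  add_mem' := by
    intro a b ha hb x
    have := add_nonneg (ha x) (hb x)
    simp only [Prod.fst_add, Prod.snd_add, map_add, CompactlySupportedContinuousMap.add_apply]
    linarith
  smul_mem' := by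
    rintro ⟨c, hc⟩ z hz x
    have := mul_nonneg hc (hz x)
    simpa [Nonneg.mk_smul, mul_add] using this

/-- A linear functional that is nonnegative on the polynomials nonnegative on `S` extends
compatibly with positivity to the compactly supported continuous functions on `S`. -/
lemma exists_positive_extension (L : MvPolynomial (Fin n) ℝ →ₗ[ℝ] ℝ)
    (hL : ∀ p, (∀ x ∈ S, 0 ≤ eval x p) → 0 ≤ L p) :
    ∃ Λ : C_c(S, ℝ) →ₗ[ℝ] ℝ, ∀ (p : MvPolynomial (Fin n) ℝ) (f : C_c(S, ℝ)),
      (∀ x : S, 0 ≤ eval (x : Fin n → ℝ) p + f x) → 0 ≤ L p + Λ f := by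
  let F : (MvPolynomial (Fin n) ℝ × C_c(S, ℝ)) →ₗ.[ℝ] ℝ :=
    (L.comp (LinearMap.fst ℝ _ _)).toPMap (Submodule.prod ⊤ ⊥)
  obtain ⟨g, hgF, hg⟩ := riesz_extension (nonnegCone S) F
    (by
      rintro ⟨⟨p, f⟩, hpf⟩ h
      obtain rfl : f = 0 := hpf.2
      exact hL p fun x hx => by simpa using h ⟨x, hx⟩)
    (by
      rintro ⟨q, f⟩
      obtain ⟨c, hc⟩ := f.hasCompactSupport.exists_bound_of_continuous f.continuous
      refine ⟨⟨(C c - q, 0), by simp [F]⟩, fun x => ?_⟩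
      have := (abs_le.1 (hc x)).1
      simp only [Prod.fst_add, Prod.snd_add, map_add, map_sub, eval_C, zero_add]
      linarith)
  refine ⟨g.comp (LinearMap.inr ℝ _ _), fun p f h => ?_⟩
  have h₁ : g (p, 0) = L p := hgF ⟨(p, 0), by simp [F]⟩
  have h₂ : (p, f) = (p, 0) + ((0, f) : MvPolynomial (Fin n) ℝ × C_c(S, ℝ)) := by simp
  have h₃ := hg (p, f) h
  rw [h₂, map_add, h₁] at h₃
  exact h₃

/-- The polynomial `1 + ∑ Xᵢ²`. -/
noncomputable def growthPoly (n : ℕ) : MvPolynomial (Fin n) ℝ := 1 + ∑ i, X i ^ 2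

lemma eval_growthPoly (x : Fin n → ℝ) : eval x (growthPoly n) = 1 + ∑ i, x i ^ 2 := by
  simp [growthPoly]

lemma eval_growthPoly_pos (x : Fin n → ℝ) : 0 < eval x (growthPoly n) := by
  rw [eval_growthPoly]; positivity

lemma isCompact_growthPoly_le (hS : IsClosed S) (c : ℝ) :
    IsCompact {x : S | eval (x : Fin n → ℝ) (growthPoly n) ≤ c} := by
  have hc : IsCompact {x : Fin n → ℝ | eval x (growthPoly n) ≤ c} := by
    refine (isCompact_Icc (a := fun _ : Fin n => -c) (b := fun _ => c)).of_isClosed_subset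
      (isClosed_le (growthPoly n).continuous_eval continuous_const) fun x hx => ?_
    have hi (i : Fin n) : |x i| ≤ c := by
      have h₁ : x i ^ 2 ≤ ∑ j, x j ^ 2 :=
        Finset.single_le_sum (f := fun j => x j ^ 2) (fun j _ => sq_nonneg _) (Finset.mem_univ i)
      have h₂ : 1 + ∑ j, x j ^ 2 ≤ c := (eval_growthPoly x).symm.trans_le hx
      nlinarith [sq_abs (x i), sq_nonneg (|x i| - 1)]
    exact ⟨fun i => (abs_le.1 (hi i)).1, fun i => (abs_le.1 (hi i)).2⟩
  exact hS.isClosedEmbedding_subtypeVal.isCompact_preimage hc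

/-- **Haviland's theorem**: a linear functional on polynomials that is nonnegative on the
polynomials nonnegative on the closed set `S` is integration against a measure on `S`. -/
theorem exists_measure (hS : IsClosed S) (L : MvPolynomial (Fin n) ℝ →ₗ[ℝ] ℝ)
    (hL : ∀ p, (∀ x ∈ S, 0 ≤ eval x p) → 0 ≤ L p) :
    ∃ μ : Measure S, ∀ p : MvPolynomial (Fin n) ℝ,
      Integrable (fun y : S => eval (y : Fin n → ℝ) p) μ ∧
        L p = ∫ y : S, eval (y : Fin n → ℝ) p ∂μ := by
  obtain ⟨Λ, hΛ⟩ := exists_positive_extension L hL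
  have : LocallyCompactSpace S := hS.locallyCompactSpace
  let Λ' : C_c(S, ℝ) →ₚ[ℝ] ℝ := PositiveLinearMap.mk₀ Λ fun f hf => by
    simpa using hΛ 0 f fun x => by simpa using hf x
  let μ : Measure S := RealRMK.rieszMeasure Λ'
  have hμ (f : C_c(S, ℝ)) : ∫ x, f x ∂μ = Λ f := RealRMK.integral_rieszMeasure Λ' f
  let K (k : ℕ) : Set S := {x | eval (x : Fin n → ℝ) (growthPoly n) ≤ k}
  have hK (k : ℕ) : IsCompact (K k) := isCompact_growthPoly_le hS k
  have hcover : AECover μ atTop K :=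
    ⟨ae_of_all _ fun x => (tendsto_natCast_atTop_atTop (R := ℝ)).eventually_ge_atTop _,
      fun k => (hK k).measurableSet⟩
  have hχ (k : ℕ) : ∃ χ : C_c(S, ℝ), Set.EqOn χ 1 (K k) ∧ ∀ x, χ x ∈ Set.Icc (0 : ℝ) 1 := by
    obtain ⟨f, hf₁, hf₂, -, hf₃⟩ :=
      exists_continuousMap_one_of_isCompact_subset_isOpen (hK k) isOpen_univ (Set.subset_univ _)
    exact ⟨⟨f, hf₂⟩, hf₁, hf₃⟩
  choose χ hχ₁ hχ₂ using hχ
  have key (p : MvPolynomial (Fin n) ℝ) (hp : ∀ x, 0 ≤ eval x p) :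
      Integrable (fun y : S => eval (y : Fin n → ℝ) p) μ ∧
        L p = ∫ y : S, eval (y : Fin n → ℝ) p ∂μ := by
    have hle (k : ℕ) (x : S) : polyMul p (χ k) x ≤ eval (x : Fin n → ℝ) p :=
      mul_le_of_le_one_right (hp x) (hχ₂ k x).2
    have hnn (k : ℕ) (x : S) : 0 ≤ polyMul p (χ k) x := mul_nonneg (hp x) (hχ₂ k x).1
    have hon (k : ℕ) : IntegrableOn (fun y : S => eval (y : Fin n → ℝ) p) (K k) μ :=
      (evalOn S p).continuous.continuousOn.integrableOn_compact (hK k)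
    have hbound (k : ℕ) : ∫ y in K k, eval (y : Fin n → ℝ) p ∂μ ≤ L p := calc
      _ = ∫ y in K k, polyMul p (χ k) y ∂μ :=
        setIntegral_congr_fun (hK k).measurableSet fun y hy => by simp [hχ₁ k hy]
      _ ≤ ∫ y, polyMul p (χ k) y ∂μ :=
        setIntegral_le_integral (polyMul p (χ k)).integrable (ae_of_all _ (hnn k))
      _ = Λ (polyMul p (χ k)) := hμ _
      _ ≤ L p := by
        have := hΛ p (-polyMul p (χ k)) fun x => by
          simpa using sub_nonneg.2 (hle k x)
        rw [map_neg] at this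
        linarith
    have hint : Integrable (fun y : S => eval (y : Fin n → ℝ) p) μ :=
      hcover.integrable_of_integral_bounded_of_nonneg_ae (L p) hon
        (ae_of_all _ fun y => hp y) (Eventually.of_forall hbound)
    refine ⟨hint, le_antisymm ?_ ?_⟩
    · have hk (k : ℕ) (hk₀ : 0 < k) : L p ≤ (k : ℝ)⁻¹ * L (p * growthPoly n)
          + ∫ y : S, eval (y : Fin n → ℝ) p ∂μ := by
        have h₁ : ∫ y, polyMul p (χ k) y ∂μ ≤ ∫ y : S, eval (y : Fin n → ℝ) p ∂μ :=
          integral_mono (polyMul p (χ k)).integrable hint (hle k)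
        have h₂ := hΛ ((k : ℝ)⁻¹ • (p * growthPoly n) - p) (polyMul p (χ k)) fun x => by
          have hq := mul_nonneg (hp x) (eval_growthPoly_pos (x : Fin n → ℝ)).le
          simp only [map_sub, smul_eval, map_mul, polyMul_apply]
          by_cases hx : x ∈ K k
          · rw [hχ₁ k hx, Pi.one_apply]
            have := mul_nonneg (inv_nonneg.2 (Nat.cast_nonneg (α := ℝ) k)) hq
            linarith
          · have hkx : (k : ℝ) ≤ eval (x : Fin n → ℝ) (growthPoly n) := (not_le.1 hx).le
            have h₃ : eval (x : Fin n → ℝ) p ≤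
                (k : ℝ)⁻¹ * (eval (x : Fin n → ℝ) p * eval (x : Fin n → ℝ) (growthPoly n)) := by
              rw [le_inv_mul_iff₀ (Nat.cast_pos.2 hk₀), mul_comm]
              exact mul_le_mul_of_nonneg_left hkx (hp x)
            have h₄ : 0 ≤ eval (x : Fin n → ℝ) p * χ k x := hnn k x
            linarith
        rw [map_sub, map_smul, smul_eq_mul, ← hμ] at h₂
        linarith
      refine ge_of_tendsto (x := atTop) ?_ ((eventually_gt_atTop 0).mono hk)
      simpa using ((tendsto_inv_atTop_nhds_zero_nat (𝕜 := ℝ)).mul_const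
        (L (p * growthPoly n))).add_const (∫ y : S, eval (y : Fin n → ℝ) p ∂μ)
    · exact le_of_tendsto' (hcover.integral_tendsto_of_countably_generated hint) hbound
  refine ⟨μ, fun p => ?_⟩
  obtain ⟨hi₁, he₁⟩ := key (p ^ 2 + 1) fun x => by
    simp only [map_add, map_pow, map_one]; positivity
  obtain ⟨hi₂, he₂⟩ := key (p ^ 2 + 1 - p) fun x => by
    simp only [map_add, map_sub, map_pow, map_one]
    nlinarith [sq_nonneg (eval x p - 1)]
  have hp (y : Fin n → ℝ) : eval y p = eval y (p ^ 2 + 1) - eval y (p ^ 2 + 1 - p) := by simp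
  have hLp : L p = L (p ^ 2 + 1) - L (p ^ 2 + 1 - p) := by rw [← map_sub]; simp
  simp_rw [hp]
  exact ⟨hi₁.sub hi₂, by rw [integral_sub hi₁ hi₂, ← he₁, ← he₂, hLp]⟩

end Haviland

/-- A linear map `Φ` on `ℝ[X₁,…,Xₙ]` is an `S`-nonnegativity preserver (for closed `S`)
if and only if for every `x ∈ S` there is a nonnegative Borel measure `μ_x` on `S`,
integrating all polynomials, with `Φ(p)(x) = ∫_S p dμ_x` for all `p`. -/
theorem nonnegativity_preserver_iff_pointwise_integral_representation
    (n : ℕ) (S : Set (Fin n → ℝ)) (hS : IsClosed S)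
    (Φ : MvPolynomial (Fin n) ℝ →ₗ[ℝ] MvPolynomial (Fin n) ℝ) :
    (∀ p : MvPolynomial (Fin n) ℝ,
      (∀ x ∈ S, 0 ≤ MvPolynomial.eval x p) → ∀ x ∈ S, 0 ≤ MvPolynomial.eval x (Φ p)) ↔
    (∀ x ∈ S, ∃ μ : Measure (Fin n → ℝ),
      μ Sᶜ = 0 ∧
      (∀ p : MvPolynomial (Fin n) ℝ, Integrable (fun y => MvPolynomial.eval y p) μ) ∧
      (∀ p : MvPolynomial (Fin n) ℝ,
        MvPolynomial.eval x (Φ p) = ∫ y, MvPolynomial.eval y p ∂μ)) := by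
  constructor
  · intro h x hx
    obtain ⟨μ, hμ⟩ := Haviland.exists_measure hS
      ((MvPolynomial.aeval x).toLinearMap.comp Φ) fun p hp => by
        simpa [MvPolynomial.aeval_eq_eval] using h p hp x hx
    have hemb := MeasurableEmbedding.subtype_coe hS.measurableSet
    refine ⟨μ.map (↑), ?_, fun p => ?_, fun p => ?_⟩
    · rw [hemb.map_apply]
      simp
    · exact hemb.integrable_map_iff.2 (hμ p).1
    · rw [hemb.integral_map, ← (hμ p).2]
      simp [MvPolynomial.aeval_eq_eval]
  · intro h p hp x hx
    obtain ⟨μ, hμ, -, hrep⟩ := h x hx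
    rw [hrep p]
    refine integral_nonneg_of_ae ?_
    filter_upwards [mem_ae_iff.2 hμ] with y hy using hp y hy
end

section
/- Let S ⊆ ℝⁿ be nonempty, compact and Zariski dense, and equip ℝ[X₁,…,Xₙ] with the norm ‖p‖_∞ := max_{x∈S} |p(x)|. Let Φ : ℝ[X₁,…,Xₙ] → ℝ[X₁,…,Xₙ] be an S-nonnegativity preserver. Then ‖Φ(p)‖_∞ ≤ ‖Φ(1)‖_∞ · ‖p‖_∞ for all polynomials p, and ‖Φ(1)‖_∞ is the least constant C ≥ 0 with ‖Φ(p)‖_∞ ≤ C·‖p‖_∞ for all p; i.e., Φ is continuous with operator norm ‖Φ‖ = ‖Φ(1)‖_∞. -/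
open MvPolynomial

/-- For nonempty compact Zariski dense `S`, an `S`-nonnegativity preserver `Φ` is
continuous for the sup-norm `‖p‖_∞ = max_{x ∈ S} |p(x)|`, with operator norm
`‖Φ‖ = ‖Φ(1)‖_∞`: one has `‖Φ(p)‖_∞ ≤ ‖Φ(1)‖_∞ ‖p‖_∞` for all `p`, and `‖Φ(1)‖_∞` is
the least constant `C ≥ 0` with this property. -/
theorem nonnegativity_preserver_continuous_with_operator_norm
    (n : ℕ) (S : Set (Fin n → ℝ)) (hne : S.Nonempty) (hc : IsCompact S)
    (hzar : ∀ p : MvPolynomial (Fin n) ℝ, (∀ x ∈ S, MvPolynomial.eval x p = 0) → p = 0)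
    (Φ : MvPolynomial (Fin n) ℝ →ₗ[ℝ] MvPolynomial (Fin n) ℝ)
    (hΦ : ∀ p : MvPolynomial (Fin n) ℝ,
      (∀ x ∈ S, 0 ≤ MvPolynomial.eval x p) → ∀ x ∈ S, 0 ≤ MvPolynomial.eval x (Φ p))
    (N : MvPolynomial (Fin n) ℝ → ℝ)
    (hN : ∀ p, IsGreatest ((fun x => |MvPolynomial.eval x p|) '' S) (N p)) :
    (∀ p : MvPolynomial (Fin n) ℝ, N (Φ p) ≤ N (Φ 1) * N p) ∧
    (∀ C : ℝ, 0 ≤ C → (∀ p : MvPolynomial (Fin n) ℝ, N (Φ p) ≤ C * N p) → N (Φ 1) ≤ C) := by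
  have le_N : ∀ p, ∀ x ∈ S, |eval x p| ≤ N p := fun p x hx => (hN p).2 ⟨x, hx, rfl⟩
  refine ⟨fun p => ?_, fun C _ h => ?_⟩
  · obtain ⟨x, hx, hxp⟩ := (hN (Φ p)).1
    have hp : 0 ≤ N p := (abs_nonneg _).trans (le_N p x hx)
    have hsub := hΦ (N p • 1 - p) (fun y hy => by
      have := (abs_le.1 (le_N p y hy)).2
      simp only [map_sub, smul_eval, map_one]
      linarith) x hx
    have hadd := hΦ (N p • 1 + p) (fun y hy => by
      have := (abs_le.1 (le_N p y hy)).1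
      simp only [map_add, smul_eval, map_one]
      linarith) x hx
    simp only [map_sub, map_add, map_smul, smul_eval] at hsub hadd
    calc N (Φ p) = |eval x (Φ p)| := hxp.symm
      _ ≤ N p * eval x (Φ 1) := abs_le.2 ⟨by linarith, by linarith⟩
      _ ≤ N p * N (Φ 1) :=
        mul_le_mul_of_nonneg_left ((le_abs_self _).trans (le_N (Φ 1) x hx)) hp
      _ = N (Φ 1) * N p := mul_comm _ _
  · have hone : N 1 = 1 := by
      obtain ⟨x, _, hx⟩ := (hN 1).1
      simpa using hx.symm
    simpa [hone] using h 1
end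

section
/- Let S ⊆ ℝⁿ be nonempty, compact and Zariski dense, let Φ : ℝ[X₁,…,Xₙ] → ℝ[X₁,…,Xₙ] be an S-nonnegativity preserver, and let (μ_x)_{x∈S} be a family of nonnegative finite Borel measures on S with Φ(p)(x) = ∫_S p dμ_x for all polynomials p and all x ∈ S. Then for every Borel set A ⊆ S, the function Φ*_A : S → [0,∞), x ↦ μ_x(A), is Borel measurable and satisfies sup_{x∈S} Φ*_A(x) ≤ ‖Φ(1)‖_∞, where ‖q‖_∞ := max_{x∈S} |q(x)|. -/
open MvPolynomial MeasureTheory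

/-- A polynomial approximates a continuous function uniformly on a compact subset of `ℝⁿ`. -/
theorem exists_mvPolynomial_near_continuous_on_compact {σ : Type*}
    {S : Set (σ → ℝ)} (hc : IsCompact S) {f : (σ → ℝ) → ℝ} (hf : Continuous f)
    {ε : ℝ} (hε : 0 < ε) :
    ∃ p : MvPolynomial σ ℝ, ∀ x ∈ S, |MvPolynomial.eval x p - f x| < ε := by
  have : CompactSpace S := isCompact_iff_compactSpace.mp hc
  let X : σ → C(S, ℝ) := fun i => ⟨fun x => x.1 i, (continuous_apply i).comp continuous_subtype_val⟩
  let F : MvPolynomial σ ℝ →ₐ[ℝ] C(S, ℝ) := MvPolynomial.aeval X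
  have hF : ∀ p (x : S), F p x = MvPolynomial.eval x.1 p := by
    intro p x
    induction p using MvPolynomial.induction_on with
    | C a => simp [F]
    | add p q hp hq => simp [hp, hq]
    | mul_X p i hp => simp [hp, F, X]
  have hsep : F.range.SeparatesPoints := by
    intro x y hxy
    obtain ⟨i, hi⟩ := Function.ne_iff.mp (Subtype.coe_injective.ne hxy)
    exact ⟨X i, ⟨X i, ⟨MvPolynomial.X i, by simp [F]⟩, rfl⟩, hi⟩
  obtain ⟨⟨g, p, hp⟩, hg⟩ :=
    ContinuousMap.exists_mem_subalgebra_near_continuousMap_of_separatesPoints F.range hsep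
      ⟨fun x : S => f x.1, by fun_prop⟩ ε hε
  refine ⟨p, fun x hx => ?_⟩
  have h := (ContinuousMap.norm_lt_iff _ hε).mp hg ⟨x, hx⟩
  rw [← hF p ⟨x, hx⟩]
  have hp' : F p = g := hp
  simpa [hp', Real.norm_eq_abs] using h

/-- A continuous function is integrable for a finite measure carried by a compact set. -/
theorem Continuous.integrable_of_measure_compl_eq_zero {X : Type*} [TopologicalSpace X]
    [T2Space X] [MeasurableSpace X] [OpensMeasurableSpace X]
    {S : Set X} (hc : IsCompact S) {μ : Measure X} [IsFiniteMeasure μ] (hμ : μ Sᶜ = 0)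
    {f : X → ℝ} (hf : Continuous f) : Integrable f μ := by
  have h : IntegrableOn f S μ := hf.continuousOn.integrableOn_compact hc
  rwa [IntegrableOn, Measure.restrict_eq_self_of_ae_mem (mem_ae_iff.mpr hμ)] at h

/-- If the moments of a family of finite measures on a compact set depend measurably on the
parameter, then so do the measures. -/
theorem measurable_measure_of_measurable_moments {α ι : Type*} [Fintype ι] [MeasurableSpace α]
    {S : Set (ι → ℝ)} (hc : IsCompact S) (μ : α → Measure (ι → ℝ))
    [∀ a, IsFiniteMeasure (μ a)] (hμ : ∀ a, μ a Sᶜ = 0)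
    (hmom : ∀ p : MvPolynomial ι ℝ, Measurable fun a => ∫ y, MvPolynomial.eval y p ∂(μ a)) :
    Measurable μ := by
  have hcont : ∀ f : (ι → ℝ) → ℝ, Continuous f → Measurable fun a => ∫ y, f y ∂(μ a) := by
    intro f hf
    choose p hp using fun k : ℕ => exists_mvPolynomial_near_continuous_on_compact hc hf
      (Nat.one_div_pos_of_nat (α := ℝ) (n := k))
    refine measurable_of_tendsto_metrizable (fun k => hmom (p k)) (tendsto_pi_nhds.mpr fun a => ?_)
    have hlim : Filter.Tendsto (fun k : ℕ => 1 / ((k : ℝ) + 1) * (μ a).real Set.univ)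
        Filter.atTop (nhds 0) := by
      simpa using tendsto_one_div_add_atTop_nhds_zero_nat.mul_const ((μ a).real Set.univ)
    rw [tendsto_iff_norm_sub_tendsto_zero]
    refine squeeze_zero (fun _ => norm_nonneg _) (fun k => ?_) hlim
    rw [← integral_sub
      ((MvPolynomial.continuous_eval (p k)).integrable_of_measure_compl_eq_zero hc (hμ a))
      (hf.integrable_of_measure_compl_eq_zero hc (hμ a))]
    refine norm_integral_le_of_norm_le_const ?_
    filter_upwards [mem_ae_iff.mpr (hμ a)] with y hy
    exact (hp k y hy).le
  have hclosed : ∀ F : Set (ι → ℝ), IsClosed F → Measurable fun a => μ a F := by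
    intro F hF
    refine measurable_of_tendsto_metrizable (fun k => ?_)
      (tendsto_pi_nhds.mpr fun a => HasOuterApproxClosed.tendsto_lintegral_apprSeq hF (μ a))
    have hk : Continuous fun y => (hF.apprSeq k y : ℝ) :=
      NNReal.continuous_coe.comp (hF.apprSeq k).continuous
    simp_rw [fun a => lintegral_coe_eq_integral _
      (hk.integrable_of_measure_compl_eq_zero hc (hμ a))]
    exact (hcont _ hk).ennreal_ofReal
  exact Measurable.measure_of_isPiSystem
    (BorelSpace.measurable_eq.trans borel_eq_generateFrom_isClosed) isPiSystem_isClosed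
    hclosed (hclosed _ isClosed_univ)

/-- For nonempty compact Zariski dense `S`, an `S`-nonnegativity preserver `Φ` and its
representing family `(μ_x)_{x∈S}` (so `Φ(p)(x) = ∫_S p dμ_x`), the function
`Φ*_A : x ↦ μ_x(A)` is Borel measurable on `S` for every Borel set `A ⊆ S`, and is
bounded by `‖Φ(1)‖_∞ = max_{x∈S} |Φ(1)(x)|`. -/
theorem adjoint_set_function_measurable_and_bounded
    (n : ℕ) (S : Set (Fin n → ℝ)) (hne : S.Nonempty) (hc : IsCompact S)
    (hzar : ∀ p : MvPolynomial (Fin n) ℝ, (∀ x ∈ S, MvPolynomial.eval x p = 0) → p = 0)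
    (Φ : MvPolynomial (Fin n) ℝ →ₗ[ℝ] MvPolynomial (Fin n) ℝ)
    (hΦ : ∀ p : MvPolynomial (Fin n) ℝ,
      (∀ x ∈ S, 0 ≤ MvPolynomial.eval x p) → ∀ x ∈ S, 0 ≤ MvPolynomial.eval x (Φ p))
    (μ : (Fin n → ℝ) → Measure (Fin n → ℝ))
    (hfin : ∀ x ∈ S, IsFiniteMeasure (μ x))
    (hsupp : ∀ x ∈ S, μ x Sᶜ = 0)
    (hrep : ∀ x ∈ S, ∀ p : MvPolynomial (Fin n) ℝ,
      MvPolynomial.eval x (Φ p) = ∫ y, MvPolynomial.eval y p ∂(μ x))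
    (N1 : ℝ) (hN1 : IsGreatest ((fun x => |MvPolynomial.eval x (Φ 1)|) '' S) N1) :
    ∀ A : Set (Fin n → ℝ), MeasurableSet A → A ⊆ S →
      Measurable (fun x : S => ((μ x) A).toReal) ∧
      ∀ x ∈ S, ((μ x) A).toReal ≤ N1 := by
  intro A hA hAS
  have : ∀ x : S, IsFiniteMeasure (μ x) := fun x => hfin x x.2
  refine ⟨?_, fun x hx => ?_⟩
  · have hmeas : Measurable fun x : S => μ x :=
      measurable_measure_of_measurable_moments hc (fun x : S => μ x) (fun x => hsupp x x.2)
        fun p => by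
          simp_rw [← fun x : S => hrep x x.2 p]
          exact ((MvPolynomial.continuous_eval (Φ p)).comp continuous_subtype_val).measurable
    exact ((Measure.measurable_coe hA).comp hmeas).ennreal_toReal
  · have := hfin x hx
    calc (μ x).real A ≤ (μ x).real Set.univ := measureReal_mono (Set.subset_univ A)
      _ = MvPolynomial.eval x (Φ 1) := by simp [hrep x hx 1]
      _ ≤ |MvPolynomial.eval x (Φ 1)| := le_abs_self _
      _ ≤ N1 := hN1.2 ⟨x, hx, rfl⟩
end

section
/- Let S ⊆ ℝⁿ be nonempty, compact and Zariski dense, let Φ : ℝ[X₁,…,Xₙ] → ℝ[X₁,…,Xₙ] be an S-nonnegativity preserver, and let (μ_x)_{x∈S} be a family of nonnegative finite Borel measures on S with Φ(p)(x) = ∫_S p dμ_x for all polynomials p and all x ∈ S. Then the following are equivalent: (i) there is some d ∈ ℕ such that for every Borel set A ⊆ S the function x ↦ μ_x(A) agrees on S with a polynomial of degree at most d; (ii) the range Φ(ℝ[X₁,…,Xₙ]) is a finite-dimensional subspace of ℝ[X₁,…,Xₙ]. -/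
open MvPolynomial MeasureTheory Filter Topology

/-- A finite-dimensional space of functions `x ↦ ∫ f ∂ν_x` is closed under bounded pointwise
limits of the integrands. -/
theorem integral_mem_of_tendsto_of_bounded {α X : Type*} [MeasurableSpace α] {ν : X → Measure α}
    [∀ x, IsFiniteMeasure (ν x)] {S : Set α} (hS : ∀ x, ∀ᵐ y ∂ν x, y ∈ S)
    (V : Submodule ℝ (X → ℝ)) [FiniteDimensional ℝ V] {f : ℕ → α → ℝ} {g : α → ℝ} {C : ℝ}
    (hf : ∀ k, Measurable (f k)) (hb : ∀ k, ∀ y ∈ S, ‖f k y‖ ≤ C)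
    (hlim : ∀ y ∈ S, Tendsto (fun k => f k y) atTop (𝓝 (g y)))
    (hV : ∀ k, (fun x => ∫ y, f k y ∂ν x) ∈ V) : (fun x => ∫ y, g y ∂ν x) ∈ V := by
  refine V.closed_of_finiteDimensional.mem_of_tendsto (b := atTop)
    (f := fun k x => ∫ y, f k y ∂ν x) (tendsto_pi_nhds.2 fun x => ?_) (Eventually.of_forall hV)
  exact tendsto_integral_of_dominated_convergence (fun _ => C)
    (fun k => (hf k).aestronglyMeasurable) (integrable_const C)
    (fun k => (hS x).mono fun y hy => hb k y hy) ((hS x).mono fun y hy => hlim y hy)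

/-- If a finite-dimensional space contains all set functions `x ↦ ν_x(A)`, then it contains
`x ↦ ∫ g ∂ν_x` for every bounded measurable `g`. -/
theorem integral_mem_of_real_measure_mem {α X : Type*} [MeasurableSpace α] {ν : X → Measure α}
    [∀ x, IsFiniteMeasure (ν x)] (V : Submodule ℝ (X → ℝ)) [FiniteDimensional ℝ V]
    (hV : ∀ A, MeasurableSet A → (fun x => (ν x).real A) ∈ V) {g : α → ℝ} (hg : Measurable g)
    {C : ℝ} (hC : 0 ≤ C) (hb : ∀ y, ‖g y‖ ≤ C) : (fun x => ∫ y, g y ∂ν x) ∈ V := by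
  have hs : StronglyMeasurable g := hg.stronglyMeasurable
  refine integral_mem_of_tendsto_of_bounded (S := Set.univ) (fun x => by simp) V
    (f := fun k => hs.approxBounded C k) (C := C) (fun k => SimpleFunc.measurable _)
    (fun k y _ => hs.norm_approxBounded_le hC k y)
    (fun y _ => hs.tendsto_approxBounded_of_norm_le (hb y)) fun k => ?_
  have h : (fun x => ∫ y, hs.approxBounded C k y ∂ν x) =
      ∑ c ∈ (hs.approxBounded C k).range,
        c • fun x => (ν x).real (hs.approxBounded C k ⁻¹' {c}) := by
    ext x
    rw [SimpleFunc.integral_eq_sum _ (SimpleFunc.integrable_of_isFiniteMeasure _)]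
    simp [mul_comm]
  rw [h]
  exact V.sum_mem fun c _ => V.smul_mem _ (hV _ (SimpleFunc.measurableSet_fiber _ _))

/-- A finite-dimensional space containing `x ↦ ∫ f ∂ν_x` for all bounded continuous `f` contains
all set functions `x ↦ ν_x(A)`. -/
theorem real_measure_mem_of_integral_mem {α X : Type*} [PseudoEMetricSpace α] [MeasurableSpace α]
    [BorelSpace α] {ν : X → Measure α} [∀ x, IsFiniteMeasure (ν x)] (V : Submodule ℝ (X → ℝ))
    [FiniteDimensional ℝ V] (hV : ∀ f : C(α, ℝ), (fun x => ∫ y, f y ∂ν x) ∈ V)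
    {A : Set α} (hA : MeasurableSet A) : (fun x => (ν x).real A) ∈ V := by
  have huniv : (fun x => (ν x).real Set.univ) ∈ V := by simpa using hV 1
  have hborel : ‹MeasurableSpace α› = MeasurableSpace.generateFrom {s | IsClosed s} :=
    BorelSpace.measurable_eq.trans borel_eq_generateFrom_isClosed
  induction A, hA using MeasurableSpace.induction_on_inter hborel isPiSystem_isClosed with
  | empty =>
    simp only [measureReal_empty]
    exact V.zero_mem
  | basic F hF =>
    have hF : IsClosed F := hF
    have h := integral_mem_of_tendsto_of_bounded (ν := ν) (S := Set.univ) (fun x => by simp) V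
      (f := fun k y => (hF.apprSeq k y : ℝ)) (g := F.indicator 1) (C := 1)
      (fun k => by fun_prop)
      (fun k y _ => by simpa using HasOuterApproxClosed.apprSeq_apply_le_one hF k y)
      (fun y _ => by
        have h := tendsto_pi_nhds.1 (HasOuterApproxClosed.tendsto_apprSeq hF) y
        convert! (NNReal.continuous_coe.tendsto _).comp h using 2
        by_cases hy : y ∈ F <;> simp [hy])
      (fun k => hV ⟨fun y => (hF.apprSeq k y : ℝ), by fun_prop⟩)
    simpa [integral_indicator_one hF.measurableSet] using h
  | compl t ht ih =>
    have h : (fun x => (ν x).real tᶜ) =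
        (fun x => (ν x).real Set.univ) - fun x => (ν x).real t := by
      ext x; simp [measureReal_compl ht]
    rw [h]
    exact V.sub_mem huniv ih
  | iUnion f hd hm ih =>
    refine V.closed_of_finiteDimensional.mem_of_tendsto (b := atTop)
      (f := fun k => ∑ i ∈ Finset.range k, fun x => (ν x).real (f i))
      (tendsto_pi_nhds.2 fun x => ?_) (Eventually.of_forall fun k => V.sum_mem fun i _ => ih i)
    have hsum : ∑' i, ν x (f i) = ν x (⋃ i, f i) := (measure_iUnion hd hm).symm
    have hfinite : ∑' i, ν x (f i) ≠ ⊤ := hsum ▸ measure_ne_top _ _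
    have h := (ENNReal.hasSum_toReal hfinite).tendsto_sum_nat
    rw [← ENNReal.tsum_toReal_eq fun i => measure_ne_top _ _, hsum] at h
    simpa [measureReal_def] using h

/-- A real polynomial as a continuous function. -/
noncomputable def polynomialToContinuousMap (n : ℕ) :
    MvPolynomial (Fin n) ℝ →ₐ[ℝ] C(Fin n → ℝ, ℝ) :=
  aeval fun i => ⟨fun x => x i, continuous_apply i⟩

theorem polynomialToContinuousMap_apply {n : ℕ} (p : MvPolynomial (Fin n) ℝ) (x : Fin n → ℝ) :
    polynomialToContinuousMap n p x = eval x p := by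
  induction p using MvPolynomial.induction_on with
  | C a => simp [polynomialToContinuousMap]
  | add p q hp hq => simp [hp, hq]
  | mul_X p i hp => simp [hp]; simp [polynomialToContinuousMap]

/-- Stone–Weierstrass for polynomials in several variables on a compact set. -/
theorem exists_mvPolynomial_near_of_isCompact {n : ℕ} {S : Set (Fin n → ℝ)} (hc : IsCompact S)
    (f : C(Fin n → ℝ, ℝ)) {ε : ℝ} (hε : 0 < ε) :
    ∃ p : MvPolynomial (Fin n) ℝ, ∀ x ∈ S, ‖eval x p - f x‖ < ε := by
  have hsep : (polynomialToContinuousMap n).range.SeparatesPoints := by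
    intro x y hxy
    obtain ⟨i, hi⟩ := Function.ne_iff.1 hxy
    exact ⟨_, ⟨_, ⟨X i, rfl⟩, rfl⟩, by simpa [polynomialToContinuousMap_apply] using hi⟩
  obtain ⟨_, ⟨p, rfl⟩, hp⟩ :=
    ContinuousMap.exists_mem_subalgebra_near_continuous_of_isCompact_of_separatesPoints
      hsep f hc hε
  exact ⟨p, fun x hx => by simpa [polynomialToContinuousMap_apply] using hp x hx⟩

/-- A finite-dimensional space containing `x ↦ ∫ p ∂ν_x` for all polynomials `p` contains
`x ↦ ∫ f ∂ν_x` for all continuous `f`, if the `ν_x` live on a common compact set. -/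
theorem integral_continuousMap_mem_of_integral_mvPolynomial_mem {n : ℕ} {X : Type*}
    {S : Set (Fin n → ℝ)} (hc : IsCompact S) {ν : X → Measure (Fin n → ℝ)}
    [∀ x, IsFiniteMeasure (ν x)] (hS : ∀ x, ∀ᵐ y ∂ν x, y ∈ S) (V : Submodule ℝ (X → ℝ))
    [FiniteDimensional ℝ V]
    (hV : ∀ p : MvPolynomial (Fin n) ℝ, (fun x => ∫ y, eval y p ∂ν x) ∈ V)
    (f : C(Fin n → ℝ, ℝ)) : (fun x => ∫ y, f y ∂ν x) ∈ V := by
  choose p hp using fun k : ℕ =>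
    exists_mvPolynomial_near_of_isCompact hc f (Nat.one_div_pos_of_nat (α := ℝ) (n := k))
  obtain ⟨C, hC⟩ := hc.exists_bound_of_continuousOn f.continuous.continuousOn
  refine integral_mem_of_tendsto_of_bounded hS V (f := fun k y => eval y (p k)) (C := 1 + C)
    (fun k => (MvPolynomial.continuous_eval _).measurable) (fun k y hy => ?_) (fun y hy => ?_)
    fun k => hV (p k)
  · have h1 : (1 : ℝ) / (k + 1) ≤ 1 := by
      rw [div_le_one (by positivity)]
      linarith [(Nat.cast_nonneg k : (0 : ℝ) ≤ k)]
    calc ‖eval y (p k)‖ = ‖(eval y (p k) - f y) + f y‖ := by simp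
      _ ≤ ‖eval y (p k) - f y‖ + ‖f y‖ := norm_add_le _ _
      _ ≤ 1 + C := add_le_add ((hp k y hy).le.trans h1) (hC y hy)
  · rw [tendsto_iff_norm_sub_tendsto_zero]
    exact squeeze_zero (fun _ => norm_nonneg _) (fun k => (hp k y hy).le)
      tendsto_one_div_add_atTop_nhds_zero_nat

/-- Restriction of polynomials to functions on a set `S`. -/
noncomputable def evalOn {n : ℕ} (S : Set (Fin n → ℝ)) :
    MvPolynomial (Fin n) ℝ →ₗ[ℝ] (S → ℝ) :=
  LinearMap.pi fun x => (aeval (x : Fin n → ℝ)).toLinearMap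

theorem evalOn_apply {n : ℕ} (S : Set (Fin n → ℝ)) (p : MvPolynomial (Fin n) ℝ) (x : S) :
    evalOn S p x = eval (x : Fin n → ℝ) p := by
  simp [evalOn, aeval_eq_eval]

/-- A finite-dimensional space of polynomials has bounded total degree. -/
theorem exists_le_restrictTotalDegree {σ : Type*} (W : Submodule ℝ (MvPolynomial σ ℝ))
    [FiniteDimensional ℝ W] : ∃ d : ℕ, W ≤ restrictTotalDegree σ ℝ d := by
  obtain ⟨s, hs⟩ := (IsNoetherian.noetherian (⊤ : Submodule ℝ W)).map W.subtype
  refine ⟨s.sup totalDegree, ?_⟩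
  have h : W = Submodule.span ℝ (s : Set (MvPolynomial σ ℝ)) := by simp [hs]
  rw [h, Submodule.span_le]
  exact fun p hp => (mem_restrictTotalDegree _ _ _).2 (Finset.le_sup (f := totalDegree) hp)

/-- For nonempty compact Zariski dense `S`, an `S`-nonnegativity preserver `Φ` with
representing family `(μ_x)_{x∈S}` has finite dimensional range if and only if there is a
`d ∈ ℕ` such that for every Borel set `A ⊆ S` the function `x ↦ μ_x(A)` agrees on `S`
with a polynomial of degree at most `d`. -/
theorem finite_dimensional_range_iff_polynomial_set_functions
    (n : ℕ) (S : Set (Fin n → ℝ)) (hne : S.Nonempty) (hc : IsCompact S)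
    (hzar : ∀ p : MvPolynomial (Fin n) ℝ, (∀ x ∈ S, MvPolynomial.eval x p = 0) → p = 0)
    (Φ : MvPolynomial (Fin n) ℝ →ₗ[ℝ] MvPolynomial (Fin n) ℝ)
    (hΦ : ∀ p : MvPolynomial (Fin n) ℝ,
      (∀ x ∈ S, 0 ≤ MvPolynomial.eval x p) → ∀ x ∈ S, 0 ≤ MvPolynomial.eval x (Φ p))
    (μ : (Fin n → ℝ) → Measure (Fin n → ℝ))
    (hfin : ∀ x ∈ S, IsFiniteMeasure (μ x))
    (hsupp : ∀ x ∈ S, μ x Sᶜ = 0)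
    (hrep : ∀ x ∈ S, ∀ p : MvPolynomial (Fin n) ℝ,
      MvPolynomial.eval x (Φ p) = ∫ y, MvPolynomial.eval y p ∂(μ x)) :
    (∃ d : ℕ, ∀ A : Set (Fin n → ℝ), MeasurableSet A → A ⊆ S →
      ∃ q : MvPolynomial (Fin n) ℝ, q.totalDegree ≤ d ∧
        ∀ x ∈ S, ((μ x) A).toReal = MvPolynomial.eval x q) ↔
    FiniteDimensional ℝ (LinearMap.range Φ) := by
  have hfin' : ∀ x : S, IsFiniteMeasure (μ x) := fun x => hfin x x.2
  have hS : ∀ x : S, ∀ᵐ y ∂μ x, y ∈ S := fun x => hsupp x x.2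
  have hrep' : ∀ p, evalOn S (Φ p) = fun x : S => ∫ y, eval y p ∂μ x := fun p => by
    ext x
    rw [evalOn_apply, hrep x x.2]
  constructor
  · rintro ⟨d, hd⟩
    let V := (restrictTotalDegree (Fin n) ℝ d).map (evalOn S)
    have hV : ∀ A, MeasurableSet A → (fun x : S => (μ x).real A) ∈ V := fun A hA => by
      obtain ⟨q, hq, hqA⟩ := hd (A ∩ S) (hA.inter hc.measurableSet) Set.inter_subset_right
      refine ⟨q, (mem_restrictTotalDegree _ _ _).2 hq, ?_⟩
      ext x
      rw [evalOn_apply, ← hqA x x.2, measureReal_def]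
      exact congrArg _ (measure_congr (inter_ae_eq_left_of_ae_eq_univ
        (eventuallyEq_univ.2 (hS x))))
    have hle : LinearMap.range Φ ≤ restrictTotalDegree (Fin n) ℝ d := by
      rintro _ ⟨p, rfl⟩
      have hpc := MvPolynomial.continuous_eval p
      obtain ⟨C, hC⟩ := hc.exists_bound_of_continuousOn hpc.continuousOn
      have hC0 : 0 ≤ C := (norm_nonneg _).trans (hC _ hne.some_mem)
      have h := integral_mem_of_real_measure_mem (ν := fun x : S => μ x) V hV
        (g := S.indicator fun y => eval y p) (hpc.measurable.indicator hc.measurableSet) hC0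
        fun y => by
          by_cases hy : y ∈ S
          · simpa [hy] using hC y hy
          · simpa [hy] using hC0
      have h' : (fun x : S => ∫ y, S.indicator (fun y => eval y p) y ∂μ x) = evalOn S (Φ p) := by
        rw [hrep']
        ext x
        exact integral_congr_ae ((hS x).mono fun y hy => Set.indicator_of_mem hy _)
      rw [h'] at h
      obtain ⟨q, hq, hqp⟩ := h
      have hqΦ : q - Φ p = 0 := hzar _ fun x hx => by
        have := congrFun hqp ⟨x, hx⟩
        simp only [evalOn_apply] at this
        simp [this]
      rwa [← sub_eq_zero.1 hqΦ]
    exact Submodule.finiteDimensional_of_le hle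
  · intro hfd
    obtain ⟨d, hd⟩ := exists_le_restrictTotalDegree (LinearMap.range Φ)
    refine ⟨d, fun A hA _ => ?_⟩
    have hV := integral_continuousMap_mem_of_integral_mvPolynomial_mem hc hS
      ((LinearMap.range Φ).map (evalOn S)) fun p => ⟨Φ p, ⟨p, rfl⟩, hrep' p⟩
    obtain ⟨q, hq, hqA⟩ := real_measure_mem_of_integral_mem _ hV hA
    refine ⟨q, (mem_restrictTotalDegree _ _ _).1 (hd hq), fun x hx => ?_⟩
    rw [← evalOn_apply S q ⟨x, hx⟩, hqA]
    rfl
end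

section
/- Let S ⊆ ℝⁿ be nonempty, compact and Zariski dense, and let Φ : ℝ[X₁,…,Xₙ] → ℝ[X₁,…,Xₙ] be an S-nonnegativity preserver. Then there exists a sequence (Ψ_j)_{j∈ℕ} of linear operators, each of the form Ψ_j(p) = Σ_{i=1}^{r_j} p(x_i^{(j)}) · f_i^{(j)} with points x_i^{(j)} ∈ S and polynomials f_i^{(j)} that are nonnegative on S, such that for every polynomial p, sup_{x∈S} |Ψ_j(p)(x) − Φ(p)(x)| → 0 as j → ∞; i.e., Φ is the limit of operators from the class 𝒲 in the strong operator topology with respect to ‖·‖_∞. -/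
open MvPolynomial Filter

/-- A nonnegative continuous function on a compact set is uniformly approximated by polynomials
that are nonnegative on that set. -/
theorem exists_mvPolynomial_nonneg_near {n : ℕ} {S : Set (Fin n → ℝ)} (hc : IsCompact S)
    {g : (Fin n → ℝ) → ℝ} (hg : ContinuousOn g S) (hg0 : ∀ x ∈ S, 0 ≤ g x)
    {ε : ℝ} (hε : 0 < ε) :
    ∃ q : MvPolynomial (Fin n) ℝ, ∀ x ∈ S,
      0 ≤ MvPolynomial.eval x q ∧ |MvPolynomial.eval x q - g x| ≤ ε := by
  have : CompactSpace S := isCompact_iff_compactSpace.mp hc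
  let X : Fin n → C(S, ℝ) := fun i =>
    ⟨fun x => x.1 i, (continuous_apply i).comp continuous_subtype_val⟩
  let A : Subalgebra ℝ C(S, ℝ) := (MvPolynomial.aeval X).range
  have hA : A.SeparatesPoints := by
    intro x y hxy
    obtain ⟨i, hi⟩ := Function.ne_iff.mp (fun h => hxy (Subtype.ext h))
    exact ⟨X i, ⟨X i, ⟨MvPolynomial.X i, MvPolynomial.aeval_X X i⟩, rfl⟩, hi⟩
  let G : C(S, ℝ) := ⟨fun x => g x + ε / 2, hg.domRestrict.add continuous_const⟩
  obtain ⟨⟨_, q, rfl⟩, hq⟩ :=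
    ContinuousMap.exists_mem_subalgebra_near_continuousMap_of_separatesPoints A hA G
      (ε / 2) (half_pos hε)
  have heval : ∀ x : S, (MvPolynomial.aeval X q : C(S, ℝ)) x = MvPolynomial.eval x.1 q := by
    intro x
    have h := MvPolynomial.comp_aeval_apply X (ContinuousMap.evalAlgHom ℝ ℝ x) q
    exact h.trans (MvPolynomial.aeval_eq_eval x.1 ▸ rfl)
  refine ⟨q, fun x hx => ?_⟩
  have h := (ContinuousMap.norm_coe_le_norm _ (⟨x, hx⟩ : S)).trans_lt hq
  have h' : |MvPolynomial.eval x q - (g x + ε / 2)| < ε / 2 := by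
    rw [← heval ⟨x, hx⟩]
    exact h
  have := hg0 x hx
  rw [abs_lt] at h'
  rw [abs_le]
  refine ⟨?_, ?_, ?_⟩ <;> linarith [h'.1, h'.2]

/-- On a compact set there are finitely many continuous nonnegative functions summing to one, each
vanishing at distance at least `δ` from its centre in the set. -/
theorem exists_continuousOn_partition_of_unity {E : Type*} [PseudoMetricSpace E] {S : Set E}
    (hc : IsCompact S) {δ : ℝ} (hδ : 0 < δ) :
    ∃ (t : Finset E) (φ : E → E → ℝ), ↑t ⊆ S ∧
      (∀ c, ContinuousOn (φ c) S) ∧ (∀ c, ∀ x ∈ S, 0 ≤ φ c x) ∧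
      (∀ x ∈ S, ∑ c ∈ t, φ c x = 1) ∧ (∀ c x, δ ≤ dist x c → φ c x = 0) := by
  obtain ⟨t, htS, hfin, hcov⟩ := hc.finite_cover_balls hδ
  lift t to Finset E using hfin
  let h : E → E → ℝ := fun c x => max 0 (δ - dist x c)
  have hh : ∀ c x, 0 ≤ h c x := fun c x => le_max_left _ _
  have hpos : ∀ x ∈ S, 0 < ∑ c ∈ t, h c x := by
    intro x hx
    obtain ⟨c, hct, hxc⟩ := Set.mem_iUnion₂.mp (hcov hx)
    exact Finset.sum_pos' (fun c _ => hh c x)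
      ⟨c, hct, lt_max_of_lt_right (sub_pos.mpr (Metric.mem_ball.mp hxc))⟩
  have hcont : ∀ c, Continuous (h c) := fun c => by fun_prop
  refine ⟨t, fun c x => h c x / ∑ d ∈ t, h d x, htS, fun c => ?_, fun c x hx => ?_,
    fun x hx => ?_, fun c x hcx => ?_⟩
  · exact (hcont c).continuousOn.div
      (continuous_finsetSum t fun d _ => hcont d).continuousOn fun x hx => (hpos x hx).ne'
  · exact div_nonneg (hh c x) (hpos x hx).le
  · rw [← Finset.sum_div, div_self (hpos x hx).ne']
  · have : h c x = 0 := max_eq_left (by linarith)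
    simp [this]

/-- Polynomials are approximated on a compact set by sampling at finitely many points against
nonnegative polynomials, with an error governed by the modulus of continuity at scale `δ`. -/
theorem exists_sampling_approximation {n : ℕ} {S : Set (Fin n → ℝ)} (hc : IsCompact S)
    {δ : ℝ} (hδ : 0 < δ) :
    ∃ (t : Finset (Fin n → ℝ)) (q : (Fin n → ℝ) → MvPolynomial (Fin n) ℝ), ↑t ⊆ S ∧
      (∀ c, ∀ x ∈ S, 0 ≤ MvPolynomial.eval x (q c)) ∧
      ∀ (p : (Fin n → ℝ) → ℝ) (M η : ℝ), (∀ x ∈ S, |p x| ≤ M) →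
        (∀ x ∈ S, ∀ y ∈ S, dist x y < δ → |p x - p y| ≤ η) →
        ∀ x ∈ S, |p x - ∑ c ∈ t, p c * MvPolynomial.eval x (q c)| ≤ η + M * δ := by
  obtain ⟨t, φ, htS, hφc, hφ0, hφ1, hφδ⟩ := exists_continuousOn_partition_of_unity hc hδ
  have hε : 0 < δ / (t.card + 1) := by positivity
  choose q hq using fun c => exists_mvPolynomial_nonneg_near hc (hφc c) (hφ0 c) hε
  refine ⟨t, q, htS, fun c x hx => (hq c x hx).1, fun p M η hM hη x hx => ?_⟩
  have hM0 : 0 ≤ M := (abs_nonneg _).trans (hM x hx)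
  have hsplit : p x - ∑ c ∈ t, p c * MvPolynomial.eval x (q c)
      = ∑ c ∈ t, (p x - p c) * φ c x
        + ∑ c ∈ t, p c * (φ c x - MvPolynomial.eval x (q c)) := by
    simp only [sub_mul, mul_sub, Finset.sum_sub_distrib, ← Finset.mul_sum, hφ1 x hx]
    ring
  have h1 : |∑ c ∈ t, (p x - p c) * φ c x| ≤ η := by
    calc |∑ c ∈ t, (p x - p c) * φ c x| ≤ ∑ c ∈ t, |(p x - p c) * φ c x| :=
          Finset.abs_sum_le_sum_abs _ _
      _ ≤ ∑ c ∈ t, η * φ c x := by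
          refine Finset.sum_le_sum fun c hct => ?_
          rw [abs_mul, abs_of_nonneg (hφ0 c x hx)]
          rcases lt_or_ge (dist x c) δ with hd | hd
          · exact mul_le_mul_of_nonneg_right (hη x hx c (htS hct) hd) (hφ0 c x hx)
          · simp [hφδ c x hd]
      _ = η := by rw [← Finset.mul_sum, hφ1 x hx, mul_one]
  have h2 : |∑ c ∈ t, p c * (φ c x - MvPolynomial.eval x (q c))| ≤ M * δ := by
    calc |∑ c ∈ t, p c * (φ c x - MvPolynomial.eval x (q c))|
        ≤ ∑ c ∈ t, |p c * (φ c x - MvPolynomial.eval x (q c))| :=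
          Finset.abs_sum_le_sum_abs _ _
      _ ≤ ∑ c ∈ t, M * (δ / (t.card + 1)) := by
          refine Finset.sum_le_sum fun c hct => ?_
          rw [abs_mul, abs_sub_comm]
          exact mul_le_mul (hM c (htS hct)) (hq c x hx).2 (abs_nonneg _) hM0
      _ = M * (t.card * (δ / (t.card + 1))) := by
          rw [Finset.sum_const, nsmul_eq_mul]
          ring
      _ ≤ M * δ := by
          refine mul_le_mul_of_nonneg_left ?_ hM0
          rw [mul_div_assoc', div_le_iff₀ (by positivity)]
          nlinarith
  rw [hsplit]
  exact (abs_add_le _ _).trans (add_le_add h1 h2)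

/-- If `|p| ≤ m` on `S`, then a nonnegativity preserver `Φ` satisfies `|Φ p| ≤ m * Φ 1` on `S`. -/
theorem abs_eval_le_of_nonnegativity_preserver {n : ℕ} {S : Set (Fin n → ℝ)}
    {Φ : MvPolynomial (Fin n) ℝ →ₗ[ℝ] MvPolynomial (Fin n) ℝ}
    (hΦ : ∀ p : MvPolynomial (Fin n) ℝ,
      (∀ x ∈ S, 0 ≤ MvPolynomial.eval x p) → ∀ x ∈ S, 0 ≤ MvPolynomial.eval x (Φ p))
    {p : MvPolynomial (Fin n) ℝ} {m : ℝ} (hp : ∀ x ∈ S, |MvPolynomial.eval x p| ≤ m)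
    {x : Fin n → ℝ} (hx : x ∈ S) :
    |MvPolynomial.eval x (Φ p)| ≤ m * MvPolynomial.eval x (Φ 1) := by
  have h1 := hΦ (m • 1 - p) (fun y hy => by
    simpa [smul_eval] using (abs_le.mp (hp y hy)).2) x hx
  have h2 := hΦ (m • 1 + p) (fun y hy => by
    have := (abs_le.mp (hp y hy)).1
    simp only [map_add, smul_eval, map_one, mul_one]
    linarith) x hx
  simp only [map_sub, map_add, map_smul, smul_eval] at h1 h2
  rw [abs_le]
  constructor <;> linarith

/-- For nonempty compact Zariski dense `S`, every `S`-nonnegativity preserver `Φ` is the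
strong-operator-topology limit (w.r.t. `‖·‖_∞` on `S`) of a sequence of operators of the
form `p ↦ Σᵢ p(xᵢ)·fᵢ` with points `xᵢ ∈ S` and polynomials `fᵢ` nonnegative on `S`. -/
theorem approximation_by_simple_nonnegativity_preservers
    (n : ℕ) (S : Set (Fin n → ℝ)) (hne : S.Nonempty) (hc : IsCompact S)
    (hzar : ∀ p : MvPolynomial (Fin n) ℝ, (∀ x ∈ S, MvPolynomial.eval x p = 0) → p = 0)
    (Φ : MvPolynomial (Fin n) ℝ →ₗ[ℝ] MvPolynomial (Fin n) ℝ)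
    (hΦ : ∀ p : MvPolynomial (Fin n) ℝ,
      (∀ x ∈ S, 0 ≤ MvPolynomial.eval x p) → ∀ x ∈ S, 0 ≤ MvPolynomial.eval x (Φ p)) :
    ∃ (r : ℕ → ℕ) (xpt : (j : ℕ) → Fin (r j) → (Fin n → ℝ))
      (f : (j : ℕ) → Fin (r j) → MvPolynomial (Fin n) ℝ),
      (∀ j i, xpt j i ∈ S) ∧
      (∀ j i, ∀ x ∈ S, 0 ≤ MvPolynomial.eval x (f j i)) ∧
      (∀ p : MvPolynomial (Fin n) ℝ,
        Tendsto (fun j => sSup ((fun x =>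
            |MvPolynomial.eval x (∑ i, MvPolynomial.eval (xpt j i) p • f j i)
              - MvPolynomial.eval x (Φ p)|) '' S))
          atTop (nhds 0)) := by
  choose t q htS hq0 hq using fun j : ℕ =>
    exists_sampling_approximation hc (Nat.one_div_pos_of_nat (α := ℝ) (n := j))
  refine ⟨fun j => (t j).card, fun j i => ((t j).equivFin.symm i : Fin n → ℝ),
    fun j i => Φ (q j ((t j).equivFin.symm i)), fun j i => htS j ((t j).equivFin.symm i).2,
    fun j i => hΦ _ (hq0 j _), fun p => ?_⟩
  have hsum : ∀ j, (∑ i, MvPolynomial.eval ((t j).equivFin.symm i : Fin n → ℝ) p •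
      Φ (q j ((t j).equivFin.symm i))) = Φ (∑ c ∈ t j, MvPolynomial.eval c p • q j c) := by
    intro j
    rw [Equiv.sum_comp (t j).equivFin.symm
      (fun c : t j => MvPolynomial.eval (c : Fin n → ℝ) p • Φ (q j c)),
      Finset.sum_coe_sort (t j) (fun c => MvPolynomial.eval c p • Φ (q j c))]
    simp only [map_sum, map_smul]
  obtain ⟨M, hM⟩ := hc.exists_bound_of_continuousOn (MvPolynomial.continuous_eval p).continuousOn
  obtain ⟨C, hC⟩ := hc.exists_bound_of_continuousOn
    (MvPolynomial.continuous_eval (Φ 1)).continuousOn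
  obtain ⟨x₀, hx₀⟩ := hne
  have hC0 : 0 ≤ C := (norm_nonneg _).trans (hC x₀ hx₀)
  have hM0 : 0 ≤ M := (norm_nonneg _).trans (hM x₀ hx₀)
  rw [Metric.tendsto_nhds]
  intro ε hε
  have hη : 0 < ε / (2 * (C + 1)) := by positivity
  obtain ⟨δ, hδ, hunif⟩ := Metric.uniformContinuousOn_iff.mp
    (hc.uniformContinuousOn_of_continuous (MvPolynomial.continuous_eval p).continuousOn) _ hη
  have hlim := tendsto_one_div_add_atTop_nhds_zero_nat (𝕜 := ℝ)
  have hlim' : Tendsto (fun j : ℕ => (ε / (2 * (C + 1)) + M * (1 / ((j : ℝ) + 1))) * C) atTop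
      (nhds ((ε / (2 * (C + 1)) + M * 0) * C)) :=
    ((hlim.const_mul M).const_add _).mul_const C
  have hlt : (ε / (2 * (C + 1)) + M * 0) * C < ε := by
    rw [mul_zero, add_zero, div_mul_eq_mul_div, div_lt_iff₀ (by positivity)]
    nlinarith
  filter_upwards [hlim.eventually_lt_const hδ, hlim'.eventually_lt_const hlt] with j hj hj'
  rw [Real.dist_eq, sub_zero, abs_of_nonneg (Real.sSup_nonneg (by
    rintro _ ⟨x, -, rfl⟩
    exact abs_nonneg _))]
  refine lt_of_le_of_lt (csSup_le (Set.Nonempty.image _ ⟨x₀, hx₀⟩) ?_) hj'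
  rintro _ ⟨x, hx, rfl⟩
  have happ : ∀ y ∈ S, |MvPolynomial.eval y (∑ c ∈ t j, MvPolynomial.eval c p • q j c - p)|
      ≤ ε / (2 * (C + 1)) + M * (1 / ((j : ℝ) + 1)) := by
    intro y hy
    have := hq j (fun z => MvPolynomial.eval z p) M _ hM
      (fun z hz w hw hzw => (hunif z hz w hw (hzw.trans hj)).le) y hy
    rw [abs_sub_comm] at this
    simpa only [map_sub, map_sum, smul_eval] using this
  have hb := abs_eval_le_of_nonnegativity_preserver hΦ happ hx
  simp only [hsum]
  rw [← map_sub, ← map_sub]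
  exact hb.trans (mul_le_mul_of_nonneg_left ((le_abs_self _).trans (hC x hx)) (by positivity))
end
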